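/- arXiv:2103.12881 — 2 statements merged into one kernel-verified Lean document; each statement's English description precedes it below -/
import Mathlib

section
/- In any controlled hidden Markov model with output-feedback policy over horizon T ≥ 1, the smoother entropy satisfies the additive decomposition H(X^T | Y^T, U^{T-1}) = ∑_{t=0}^{T} [ H(X_t | Y^t, U^{t-1}) − H(X_t | Y^{t-1}, U^{t-1}) + H(X_t | X_{t-1}, Y^{t-1}, U^{t-1}) ], where the t = 0 terms are interpreted as H(X_0 | Y^0, U^{-1}) = H(X_0 | Y_0) and H(X_0 | Y^{-1}, U^{-1}) = H(X_0 | X_{-1}, Y^{-1}, U^{-1}) = H(X_0). -/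
open Finset

/-- Trajectory space of a controlled HMM over horizon `T`:
states `x_0,…,x_T`, measurements `y_0,…,y_T`, controls `u_0,…,u_{T-1}`. -/
abbrev Traj (T : ℕ) (X Y U : Type*) : Type _ :=
  (Fin (T + 1) → X) × (Fin (T + 1) → Y) × (Fin T → U)

/-- A controlled hidden Markov model with output-feedback policy over horizon `T`,
with finite state space `X`, measurement space `Y` and control space `U`.
`f t x' x u = f_t(x' | x, u)`, `g0 y x = g₀(y | x)`, `g t y x u = g_{t+1}(y | x, u_t)`,
and `pol t a ys us = μ_t(a | y^t, u^{t-1})` (causality is imposed by `pol_causal`). -/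
structure CHMM (T : ℕ) (X Y U : Type*) [Fintype X] [Fintype Y] [Fintype U] where
  p0 : X → ℝ
  f : Fin T → X → X → U → ℝ
  g0 : Y → X → ℝ
  g : Fin T → Y → X → U → ℝ
  pol : Fin T → U → (Fin (T + 1) → Y) → (Fin T → U) → ℝ
  p0_nonneg : ∀ x, 0 ≤ p0 x
  p0_sum : ∑ x, p0 x = 1
  f_nonneg : ∀ t x' x u, 0 ≤ f t x' x u
  f_sum : ∀ t x u, ∑ x', f t x' x u = 1
  g0_nonneg : ∀ y x, 0 ≤ g0 y x
  g0_sum : ∀ x, ∑ y, g0 y x = 1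
  g_nonneg : ∀ t y x u, 0 ≤ g t y x u
  g_sum : ∀ t x u, ∑ y, g t y x u = 1
  pol_nonneg : ∀ t a ys us, 0 ≤ pol t a ys us
  pol_sum : ∀ t ys us, ∑ a, pol t a ys us = 1
  pol_causal : ∀ (t : Fin T) (a : U) (ys ys' : Fin (T + 1) → Y) (us us' : Fin T → U),
    (∀ i : Fin (T + 1), (i : ℕ) ≤ (t : ℕ) → ys i = ys' i) →
    (∀ i : Fin T, (i : ℕ) < (t : ℕ) → us i = us' i) →
    pol t a ys us = pol t a ys' us'

variable {T : ℕ} {X Y U : Type*} [Fintype X] [Fintype Y] [Fintype U]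
  [DecidableEq X] [DecidableEq Y] [DecidableEq U]

/-- The joint probability mass function on trajectories induced by a controlled HMM. -/
noncomputable def CHMM.p (M : CHMM T X Y U) (ω : Traj T X Y U) : ℝ :=
  M.p0 (ω.1 0) * M.g0 (ω.2.1 0) (ω.1 0) *
    ∏ t : Fin T,
      (M.pol t (ω.2.2 t) ω.2.1 ω.2.2 *
        M.f t (ω.1 t.succ) (ω.1 t.castSucc) (ω.2.2 t) *
        M.g t (ω.2.1 t.succ) (ω.1 t.succ) (ω.2.2 t))

/-- `M.prob A a = P(A = a)` for a random variable `A` on trajectory space. -/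
noncomputable def CHMM.prob (M : CHMM T X Y U) {α : Type*} [DecidableEq α]
    (A : Traj T X Y U → α) (a : α) : ℝ :=
  ∑ ω : Traj T X Y U, if A ω = a then M.p ω else 0

/-- `M.cprob A a B b = P(A = a | B = b) = P(A = a, B = b) / P(B = b)`. -/
noncomputable def CHMM.cprob (M : CHMM T X Y U) {α β : Type*} [DecidableEq α] [DecidableEq β]
    (A : Traj T X Y U → α) (a : α) (B : Traj T X Y U → β) (b : β) : ℝ :=
  M.prob (fun ω => (A ω, B ω)) (a, b) / M.prob B b

/-- Shannon entropy `H(A)` of a random variable `A` (with `0 log 0 = 0`, as `Real.log 0 = 0`). -/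
noncomputable def CHMM.entropy (M : CHMM T X Y U) {α : Type*} [Fintype α] [DecidableEq α]
    (A : Traj T X Y U → α) : ℝ :=
  -∑ a : α, M.prob A a * Real.log (M.prob A a)

/-- Conditional entropy `H(A | B) = -∑_{a,b} P(A=a,B=b) log P(A=a|B=b)`
(terms with `P(A=a,B=b) = 0`, in particular those with `P(B=b) = 0`, vanish). -/
noncomputable def CHMM.condEnt (M : CHMM T X Y U) {α β : Type*}
    [Fintype α] [DecidableEq α] [Fintype β] [DecidableEq β]
    (A : Traj T X Y U → α) (B : Traj T X Y U → β) : ℝ :=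
  -∑ a : α, ∑ b : β,
      M.prob (fun ω => (A ω, B ω)) (a, b) *
        Real.log (M.prob (fun ω => (A ω, B ω)) (a, b) / M.prob B b)

/-- Conditional mutual information `I(A ; B | C) = H(A | C) - H(A | B, C)`. -/
noncomputable def CHMM.condMI (M : CHMM T X Y U) {α β γ : Type*}
    [Fintype α] [DecidableEq α] [Fintype β] [DecidableEq β] [Fintype γ] [DecidableEq γ]
    (A : Traj T X Y U → α) (B : Traj T X Y U → β) (C : Traj T X Y U → γ) : ℝ :=
  M.condEnt A C - M.condEnt A (fun ω => (B ω, C ω))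

/-- Point-wise conditional entropy `h(A | b) = -∑_a P(A=a|B=b) log P(A=a|B=b)`. -/
noncomputable def CHMM.pcondEnt (M : CHMM T X Y U) {α β : Type*}
    [Fintype α] [DecidableEq α] [DecidableEq β]
    (A : Traj T X Y U → α) (B : Traj T X Y U → β) (b : β) : ℝ :=
  -∑ a : α, M.cprob A a B b * Real.log (M.cprob A a B b)

/-- Point-wise conditional entropy of `A` given the random variable `A'` and the
realization `B = b`:  `h(A | A', b) = -∑_{a,a'} P(A=a,A'=a'|B=b) log P(A=a|A'=a',B=b)`. -/
noncomputable def CHMM.pcondEnt2 (M : CHMM T X Y U) {α α' β : Type*}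
    [Fintype α] [DecidableEq α] [Fintype α'] [DecidableEq α'] [DecidableEq β]
    (A : Traj T X Y U → α) (A' : Traj T X Y U → α') (B : Traj T X Y U → β) (b : β) : ℝ :=
  -∑ a : α, ∑ a' : α',
      M.cprob (fun ω => (A ω, A' ω)) (a, a') B b *
        Real.log (M.prob (fun ω => (A ω, (A' ω, B ω))) (a, (a', b)) /
          M.prob (fun ω => (A' ω, B ω)) (a', b))

/-- The state history `X^{n-1} = (X_0, …, X_{n-1})` as a random variable. -/
def Xpref (T : ℕ) {X Y U : Type*} (n : ℕ) (h : n ≤ T + 1) :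
    Traj T X Y U → (Fin n → X) :=
  fun ω i => ω.1 (Fin.castLE h i)

/-- The measurement history `Y^{n-1} = (Y_0, …, Y_{n-1})` as a random variable. -/
def Ypref (T : ℕ) {X Y U : Type*} (n : ℕ) (h : n ≤ T + 1) :
    Traj T X Y U → (Fin n → Y) :=
  fun ω i => ω.2.1 (Fin.castLE h i)

/-- The control history `U^{n-1} = (U_0, …, U_{n-1})` as a random variable. -/
def Upref (T : ℕ) {X Y U : Type*} (n : ℕ) (h : n ≤ T) :
    Traj T X Y U → (Fin n → U) :=
  fun ω i => ω.2.2 (Fin.castLE h i)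

/-- The state `X_t` as a random variable. -/
def Xat (T : ℕ) {X Y U : Type*} (t : ℕ) (h : t < T + 1) : Traj T X Y U → X :=
  fun ω => ω.1 ⟨t, h⟩

/-- The measurement `Y_t` as a random variable. -/
def Yat (T : ℕ) {X Y U : Type*} (t : ℕ) (h : t < T + 1) : Traj T X Y U → Y :=
  fun ω => ω.2.1 ⟨t, h⟩

/-- The control `U_t` as a random variable. -/
def Uat (T : ℕ) {X Y U : Type*} (t : ℕ) (h : t < T) : Traj T X Y U → U :=
  fun ω => ω.2.2 ⟨t, h⟩

set_option linter.unusedSectionVars false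

section Generic

variable {Ω V : Type*} [Fintype Ω] [Fintype V]

lemma sum_upd (upd : Ω → V → Ω) (get : Ω → V)
    (h1 : ∀ ω v, upd (upd ω v) (get ω) = ω) (h2 : ∀ ω v, get (upd ω v) = v) (H : Ω → ℝ) :
    ∑ ω, ∑ v, H (upd ω v) = (Fintype.card V : ℝ) * ∑ ω, H ω := by
  have e : ∑ q : Ω × V, H (upd q.1 q.2) = ∑ q : Ω × V, H q.1 := by
    refine Finset.sum_bij' (fun q _ => (upd q.1 q.2, get q.1)) (fun q _ => (upd q.1 q.2, get q.1))
      ?_ ?_ ?_ ?_ ?_ <;> simp [h1, h2]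
  rw [Fintype.sum_prod_type, Fintype.sum_prod_type] at e
  rw [e]
  simp [Finset.mul_sum]

lemma sum_upd_zero (upd : Ω → V → Ω) (get : Ω → V)
    (h1 : ∀ ω v, upd (upd ω v) (get ω) = ω) (h2 : ∀ ω v, get (upd ω v) = v) (H : Ω → ℝ)
    (h : ∑ ω, ∑ v, H (upd ω v) = 0) : ∑ ω, H ω = 0 := by
  rw [sum_upd upd get h1 h2] at h
  rcases mul_eq_zero.1 h with h | h
  · rcases isEmpty_or_nonempty Ω with hΩ | ⟨⟨ω⟩⟩
    · simp
    · have : Nonempty V := ⟨get ω⟩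
      exact absurd h (by exact_mod_cast Fintype.card_ne_zero)
  · exact h

lemma kernel_elim (upd : Ω → V → Ω) (get : Ω → V)
    (h1 : ∀ ω v, upd (upd ω v) (get ω) = ω) (h2 : ∀ ω v, get (upd ω v) = v)
    (κ : V → Ω → ℝ) (hκ : ∀ v ω w, κ v (upd ω w) = κ v ω) (hs : ∀ ω, ∑ v, κ v ω = 1)
    (G : Ω → ℝ) (hG : ∀ ω v, G (upd ω v) = G ω) (h : ∑ ω, G ω = 0) :
    ∑ ω, G ω * κ (get ω) ω = 0 := by
  apply sum_upd_zero upd get h1 h2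
  simp only [h2, hκ, hG, ← Finset.mul_sum, hs, mul_one, h]

lemma kernel_ci [DecidableEq V] {α : Type*} [DecidableEq α] (upd : Ω → V → Ω) (get : Ω → V)
    (h1 : ∀ ω v, upd (upd ω v) (get ω) = ω) (h2 : ∀ ω v, get (upd ω v) = v)
    (κ : V → Ω → ℝ) (hκ : ∀ v ω w, κ v (upd ω w) = κ v ω) (hs : ∀ ω, ∑ v, κ v ω = 1)
    (W : Ω → ℝ) (hW : ∀ ω v, W (upd ω v) = W ω)
    (A : Ω → α) (hA : ∀ ω v, A (upd ω v) = A ω)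
    (d : V) (ω₀ : Ω) (hd : ∀ ω, A ω = A ω₀ → κ d ω = κ d ω₀) :
    ∑ ω, ((if A ω = A ω₀ then ((if get ω = d then 1 else 0) - κ d ω₀) else 0) * W ω)
      * κ (get ω) ω = 0 := by
  apply sum_upd_zero upd get h1 h2
  apply Finset.sum_eq_zero
  intro ω _
  simp only [h2, hκ, hW, hA]
  by_cases hc : A ω = A ω₀
  · simp only [hc, if_true]
    have : ∀ v, ((if v = d then (1:ℝ) else 0) - κ d ω₀) * W ω * κ v ω
        = W ω * ((if v = d then κ v ω else 0) - κ d ω₀ * κ v ω) := by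
      intro v; split_ifs <;> ring
    simp only [this, ← Finset.mul_sum, Finset.sum_sub_distrib, hs]
    simp [hd ω hc]
  · simp [hc]

end Generic

lemma CHMM.p_nonneg (M : CHMM T X Y U) (ω : Traj T X Y U) : 0 ≤ M.p ω := by
  unfold CHMM.p
  exact mul_nonneg (mul_nonneg (M.p0_nonneg _) (M.g0_nonneg _ _))
    (Finset.prod_nonneg fun t _ => mul_nonneg (mul_nonneg (M.pol_nonneg _ _ _ _)
      (M.f_nonneg _ _ _ _)) (M.g_nonneg _ _ _ _))

lemma CHMM.prob_pos (M : CHMM T X Y U) {α : Type*} [DecidableEq α]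
    (A : Traj T X Y U → α) (ω : Traj T X Y U) (h : M.p ω ≠ 0) : 0 < M.prob A (A ω) := by
  unfold CHMM.prob
  apply Finset.sum_pos'
  · intro i _
    split_ifs
    · exact M.p_nonneg i
    · exact le_rfl
  · exact ⟨ω, Finset.mem_univ _, by simpa using lt_of_le_of_ne (M.p_nonneg ω) (Ne.symm h)⟩

lemma CHMM.sum_prob (M : CHMM T X Y U) {α : Type*} [Fintype α] [DecidableEq α]
    (A : Traj T X Y U → α) (L : α → ℝ) :
    ∑ a, M.prob A a * L a = ∑ ω, M.p ω * L (A ω) := by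
  unfold CHMM.prob
  simp only [Finset.sum_mul]
  rw [Finset.sum_comm]
  apply Finset.sum_congr rfl
  intro ω _
  simp [ite_mul]

lemma CHMM.entropy_eq (M : CHMM T X Y U) {α : Type*} [Fintype α] [DecidableEq α]
    (A : Traj T X Y U → α) :
    M.entropy A = -∑ ω, M.p ω * Real.log (M.prob A (A ω)) := by
  unfold CHMM.entropy
  rw [M.sum_prob A (fun a => Real.log (M.prob A a))]

lemma CHMM.condEnt_eq (M : CHMM T X Y U) {α β : Type*}
    [Fintype α] [DecidableEq α] [Fintype β] [DecidableEq β]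
    (A : Traj T X Y U → α) (B : Traj T X Y U → β) :
    M.condEnt A B = -∑ ω, M.p ω *
      Real.log (M.prob (fun ω => (A ω, B ω)) (A ω, B ω) / M.prob B (B ω)) := by
  unfold CHMM.condEnt
  rw [← M.sum_prob (fun ω => (A ω, B ω))
    (fun c => Real.log (M.prob (fun ω => (A ω, B ω)) c / M.prob B c.2)), Fintype.sum_prod_type]

lemma CHMM.condEnt_sub (M : CHMM T X Y U) {α β : Type*}
    [Fintype α] [DecidableEq α] [Fintype β] [DecidableEq β]
    (A : Traj T X Y U → α) (B : Traj T X Y U → β) :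
    M.condEnt A B = M.entropy (fun ω => (A ω, B ω)) - M.entropy B := by
  rw [M.condEnt_eq, M.entropy_eq, M.entropy_eq, neg_sub_neg, ← Finset.sum_sub_distrib,
    ← Finset.sum_neg_distrib]
  apply Finset.sum_congr rfl
  intro ω _
  by_cases h : M.p ω = 0
  · simp [h]
  · rw [Real.log_div (M.prob_pos (fun ω => (A ω, B ω)) ω h).ne' (M.prob_pos B ω h).ne']
    ring

lemma CHMM.entropy_congr (M : CHMM T X Y U) {α β : Type*}
    [Fintype α] [DecidableEq α] [Fintype β] [DecidableEq β]
    (A : Traj T X Y U → α) (B : Traj T X Y U → β)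
    (h : ∀ ω ω', A ω = A ω' ↔ B ω = B ω') : M.entropy A = M.entropy B := by
  rw [M.entropy_eq, M.entropy_eq]
  unfold CHMM.prob
  simp only [h]

lemma CHMM.condEnt_kernel (M : CHMM T X Y U) {α δ : Type*}
    [Fintype α] [DecidableEq α] [Fintype δ] [DecidableEq δ]
    (D : Traj T X Y U → δ) (A : Traj T X Y U → α) (k : δ → Traj T X Y U → ℝ)
    (h : ∀ d ω₀, ∑ ω, (if A ω = A ω₀ then ((if D ω = d then 1 else 0) - k d ω₀) else 0)
      * M.p ω = 0) :
    M.condEnt D A = -∑ ω, M.p ω * Real.log (k (D ω) ω) := by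
  rw [M.condEnt_eq]
  congr 1
  apply Finset.sum_congr rfl
  intro ω₀ _
  by_cases hp : M.p ω₀ = 0
  · simp [hp]
  have hpos := M.prob_pos A ω₀ hp
  congr 2
  rw [div_eq_iff hpos.ne']
  have := h (D ω₀) ω₀
  unfold CHMM.prob
  rw [Finset.mul_sum, ← sub_eq_zero, ← Finset.sum_sub_distrib]
  refine Eq.trans ?_ this
  apply Finset.sum_congr rfl
  intro ω _
  by_cases h1 : A ω = A ω₀ <;> by_cases h2 : D ω = D ω₀ <;> simp [h1, h2]
  ring

/-- Agreement of the first `a` states, `b` measurements and `c` controls. -/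
def Agree (a b c : ℕ) (ω ω' : Traj T X Y U) : Prop :=
  (∀ i : Fin (T + 1), (i : ℕ) < a → ω.1 i = ω'.1 i) ∧
  (∀ i : Fin (T + 1), (i : ℕ) < b → ω.2.1 i = ω'.2.1 i) ∧
  (∀ i : Fin T, (i : ℕ) < c → ω.2.2 i = ω'.2.2 i)

/-- `G` depends only on the first `a` states, `b` measurements and `c` controls. -/
def Dep (a b c : ℕ) {α : Type*} (G : Traj T X Y U → α) : Prop :=
  ∀ ω ω', Agree a b c ω ω' → G ω = G ω'

lemma Dep.mono {a b c a' b' c' : ℕ} {α : Type*} {G : Traj T X Y U → α} (h : Dep a b c G)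
    (ha : a ≤ a') (hb : b ≤ b') (hc : c ≤ c') : Dep a' b' c' G := fun ω ω' hA =>
  h ω ω' ⟨fun i hi => hA.1 i (by omega), fun i hi => hA.2.1 i (by omega),
    fun i hi => hA.2.2 i (by omega)⟩

lemma Dep.mul {a b c : ℕ} {G H : Traj T X Y U → ℝ} (h : Dep a b c G)
    (h' : Dep a b c H) : Dep a b c (fun ω => G ω * H ω) := fun ω ω' hA => by
  simp only [h ω ω' hA, h' ω ω' hA]

def updX (i : Fin (T + 1)) (ω : Traj T X Y U) (v : X) : Traj T X Y U :=
  (Function.update ω.1 i v, ω.2.1, ω.2.2)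
def updY (i : Fin (T + 1)) (ω : Traj T X Y U) (v : Y) : Traj T X Y U :=
  (ω.1, Function.update ω.2.1 i v, ω.2.2)
def updU (i : Fin T) (ω : Traj T X Y U) (v : U) : Traj T X Y U :=
  (ω.1, ω.2.1, Function.update ω.2.2 i v)

lemma Dep.updX {a b c : ℕ} {α : Type*} {G : Traj T X Y U → α} (h : Dep a b c G)
    (i : Fin (T + 1)) (hi : a ≤ i) (ω : Traj T X Y U) (v : X) : G (updX i ω v) = G ω :=
  h _ _ ⟨fun j hj => Function.update_of_ne (by rintro rfl; omega) _ _, fun _ _ => rfl,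
    fun _ _ => rfl⟩

lemma Dep.updY {a b c : ℕ} {α : Type*} {G : Traj T X Y U → α} (h : Dep a b c G)
    (i : Fin (T + 1)) (hi : b ≤ i) (ω : Traj T X Y U) (v : Y) : G (updY i ω v) = G ω :=
  h _ _ ⟨fun _ _ => rfl, fun j hj => Function.update_of_ne (by rintro rfl; omega) _ _,
    fun _ _ => rfl⟩

lemma Dep.updU {a b c : ℕ} {α : Type*} {G : Traj T X Y U → α} (h : Dep a b c G)
    (i : Fin T) (hi : c ≤ i) (ω : Traj T X Y U) (v : U) : G (updU i ω v) = G ω :=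
  h _ _ ⟨fun _ _ => rfl, fun _ _ => rfl,
    fun j hj => Function.update_of_ne (by rintro rfl; omega) _ _⟩

/-- policy kernel -/
def CHMM.kU (M : CHMM T X Y U) (t : Fin T) (v : U) (ω : Traj T X Y U) : ℝ :=
  M.pol t v ω.2.1 ω.2.2
/-- transition kernel -/
def CHMM.kX (M : CHMM T X Y U) (t : Fin T) (v : X) (ω : Traj T X Y U) : ℝ :=
  M.f t v (ω.1 t.castSucc) (ω.2.2 t)
/-- measurement kernel -/
def CHMM.kY (M : CHMM T X Y U) (t : Fin T) (v : Y) (ω : Traj T X Y U) : ℝ :=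
  M.g t v (ω.1 t.succ) (ω.2.2 t)

lemma CHMM.dep_kU (M : CHMM T X Y U) (t : Fin T) (v : U) :
    Dep 0 (t + 1) t (M.kU t v) := fun ω ω' h =>
  M.pol_causal t v _ _ _ _ (fun i hi => h.2.1 i (by omega)) (fun i hi => h.2.2 i hi)

lemma CHMM.dep_kX (M : CHMM T X Y U) (t : Fin T) (v : X) :
    Dep (t + 1) 0 (t + 1) (M.kX t v) := fun ω ω' h => by
  unfold CHMM.kX
  rw [h.1 t.castSucc (by simp), h.2.2 t (by simp)]

lemma CHMM.dep_kY (M : CHMM T X Y U) (t : Fin T) (v : Y) :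
    Dep (t + 2) 0 (t + 1) (M.kY t v) := fun ω ω' h => by
  unfold CHMM.kY
  rw [h.1 t.succ (by simp), h.2.2 t (by simp)]

lemma CHMM.dep_kU' (M : CHMM T X Y U) (t : Fin T) :
    Dep 0 (t + 1) (t + 1) (fun ω => M.kU t (ω.2.2 t) ω) := fun ω ω' h => by
  simp only [h.2.2 t (by simp)]
  exact (M.dep_kU t _).mono le_rfl le_rfl (by omega) _ _ h

lemma CHMM.dep_kX' (M : CHMM T X Y U) (t : Fin T) :
    Dep (t + 2) 0 (t + 1) (fun ω => M.kX t (ω.1 t.succ) ω) := fun ω ω' h => by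
  simp only [h.1 t.succ (by simp)]
  exact (M.dep_kX t _).mono (by omega) le_rfl (by omega) _ _ h

lemma CHMM.dep_kY' (M : CHMM T X Y U) (t : Fin T) :
    Dep (t + 2) (t + 2) (t + 1) (fun ω => M.kY t (ω.2.1 t.succ) ω) := fun ω ω' h => by
  simp only [h.2.1 t.succ (by simp)]
  exact (M.dep_kY t _).mono (by omega) (by omega) (by omega) _ _ h

lemma updX_1 (i : Fin (T + 1)) (ω : Traj T X Y U) (v : X) :
    updX i (updX i ω v) (ω.1 i) = ω := by simp [updX]
lemma updX_2 (i : Fin (T + 1)) (ω : Traj T X Y U) (v : X) : (updX i ω v).1 i = v := by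
  simp [updX]
lemma updY_1 (i : Fin (T + 1)) (ω : Traj T X Y U) (v : Y) :
    updY i (updY i ω v) (ω.2.1 i) = ω := by simp [updY]
lemma updY_2 (i : Fin (T + 1)) (ω : Traj T X Y U) (v : Y) : (updY i ω v).2.1 i = v := by
  simp [updY]
lemma updU_1 (i : Fin T) (ω : Traj T X Y U) (v : U) :
    updU i (updU i ω v) (ω.2.2 i) = ω := by simp [updU]
lemma updU_2 (i : Fin T) (ω : Traj T X Y U) (v : U) : (updU i ω v).2.2 i = v := by
  simp [updU]

lemma CHMM.elimU (M : CHMM T X Y U) (t : Fin T) {a b c : ℕ} {G : Traj T X Y U → ℝ}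
    (hG : Dep a b c G) (hc : c ≤ t) (h : ∑ ω, G ω = 0) :
    ∑ ω, G ω * M.kU t (ω.2.2 t) ω = 0 :=
  kernel_elim (updU t) (fun ω => ω.2.2 t) (updU_1 t) (updU_2 t) (M.kU t)
    (fun v => (M.dep_kU t v).updU t le_rfl) (fun _ => M.pol_sum _ _ _) G (hG.updU t hc) h

lemma CHMM.elimX (M : CHMM T X Y U) (t : Fin T) {a b c : ℕ} {G : Traj T X Y U → ℝ}
    (hG : Dep a b c G) (hc : a ≤ t + 1) (h : ∑ ω, G ω = 0) :
    ∑ ω, G ω * M.kX t (ω.1 t.succ) ω = 0 :=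
  kernel_elim (updX t.succ) (fun ω => ω.1 t.succ) (updX_1 _) (updX_2 _) (M.kX t)
    (fun v => (M.dep_kX t v).updX t.succ (by simp)) (fun _ => M.f_sum _ _ _) G
    (hG.updX t.succ (by simpa using hc)) h

lemma CHMM.elimY (M : CHMM T X Y U) (t : Fin T) {a b c : ℕ} {G : Traj T X Y U → ℝ}
    (hG : Dep a b c G) (hc : b ≤ t + 1) (h : ∑ ω, G ω = 0) :
    ∑ ω, G ω * M.kY t (ω.2.1 t.succ) ω = 0 :=
  kernel_elim (updY t.succ) (fun ω => ω.2.1 t.succ) (updY_1 _) (updY_2 _) (M.kY t)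
    (fun v => (M.dep_kY t v).updY t.succ (by simp)) (fun _ => M.g_sum _ _ _) G
    (hG.updY t.succ (by simpa using hc)) h

/-- partial products of the trajectory pmf -/
noncomputable def CHMM.F (M : CHMM T X Y U) (m : ℕ) (ω : Traj T X Y U) : ℝ :=
  M.p0 (ω.1 0) * M.g0 (ω.2.1 0) (ω.1 0) *
    ∏ t ∈ Finset.univ.filter (fun t : Fin T => (t : ℕ) < m),
      (M.kU t (ω.2.2 t) ω * M.kX t (ω.1 t.succ) ω * M.kY t (ω.2.1 t.succ) ω)

lemma CHMM.F_top (M : CHMM T X Y U) (ω : Traj T X Y U) : M.F T ω = M.p ω := by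
  unfold CHMM.F CHMM.p
  rw [Finset.filter_true_of_mem (fun t _ => t.isLt)]
  rfl

lemma CHMM.F_succ (M : CHMM T X Y U) (t : Fin T) (ω : Traj T X Y U) :
    M.F (t + 1) ω = M.F t ω * M.kU t (ω.2.2 t) ω * M.kX t (ω.1 t.succ) ω *
      M.kY t (ω.2.1 t.succ) ω := by
  unfold CHMM.F
  have : Finset.univ.filter (fun s : Fin T => (s : ℕ) < t + 1)
      = insert t (Finset.univ.filter (fun s : Fin T => (s : ℕ) < t)) := by
    ext s
    simp only [Finset.mem_filter, Finset.mem_univ, true_and, Finset.mem_insert, Fin.ext_iff]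
    omega
  rw [this, Finset.prod_insert (by simp)]
  ring

lemma CHMM.dep_F (M : CHMM T X Y U) (m : ℕ) : Dep (m + 1) (m + 1) m (M.F m) := by
  intro ω ω' h
  unfold CHMM.F
  rw [h.1 0 (by simp), h.2.1 0 (by simp)]
  congr 1
  apply Finset.prod_congr rfl
  intro t ht
  simp only [Finset.mem_filter, Finset.mem_univ, true_and] at ht
  congr 1
  · congr 1
    · exact (M.dep_kU' t).mono (by omega) (by omega) (by omega) _ _ h
    · exact (M.dep_kX' t).mono (by omega) (by omega) (by omega) _ _ h
  · exact (M.dep_kY' t).mono (by omega) (by omega) (by omega) _ _ h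

lemma CHMM.tail (M : CHMM T X Y U) (j : ℕ) : ∀ (m : ℕ) (_ : m + j = T)
    (G : Traj T X Y U → ℝ) (_ : Dep (m + 1) (m + 1) m G) (_ : ∑ ω, G ω * M.F m ω = 0),
    ∑ ω, G ω * M.p ω = 0 := by
  induction j with
  | zero =>
    intro m hm G _ h
    obtain rfl : m = T := by omega
    simpa only [M.F_top] using h
  | succ j ih =>
    intro m hm G hG h
    refine ih (m + 1) (by omega) G (hG.mono (by omega) (by omega) (by omega)) ?_
    have hF := M.F_succ (⟨m, by omega⟩ : Fin T)
    simp only at hF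
    simp only [hF, ← mul_assoc]
    have d1 := hG.mul (M.dep_F m)
    have d2 := (d1.mono le_rfl le_rfl (Nat.le_succ m)).mul
      ((M.dep_kU' ⟨m, by omega⟩).mono (Nat.zero_le _) le_rfl le_rfl)
    have d3 := (d2.mono (Nat.le_succ _) le_rfl le_rfl).mul
      ((M.dep_kX' ⟨m, by omega⟩).mono le_rfl (Nat.zero_le _) le_rfl)
    exact M.elimY _ d3 le_rfl (M.elimX _ d2 le_rfl (M.elimU _ d1 le_rfl h))

lemma dep_ind {a b c : ℕ} {α δ : Type*} [DecidableEq α] [DecidableEq δ]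
    {A : Traj T X Y U → α} {D : Traj T X Y U → δ} (hA : Dep a b c A) (hD : Dep a b c D)
    (a₀ : α) (d : δ) (r : ℝ) :
    Dep a b c (fun ω => if A ω = a₀ then ((if D ω = d then 1 else 0) - r) else 0) := by
  intro ω ω' h
  simp only [hA _ _ h, hD _ _ h]

lemma CHMM.condEnt_U (M : CHMM T X Y U) (t : Fin T) {α : Type*} [Fintype α] [DecidableEq α]
    (A : Traj T X Y U → α) (hA : Dep (t + 1) (t + 1) t A)
    (hk : ∀ d ω ω', A ω = A ω' → M.kU t d ω = M.kU t d ω') :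
    M.condEnt (fun ω => ω.2.2 t) A = -∑ ω, M.p ω * Real.log (M.kU t (ω.2.2 t) ω) := by
  apply M.condEnt_kernel
  intro d ω₀
  have hD : Dep (t + 1) (t + 1) (t + 1) (fun ω : Traj T X Y U => ω.2.2 t) :=
    fun ω ω' h => h.2.2 t (by simp)
  have dI := dep_ind (hA.mono le_rfl le_rfl (Nat.le_succ _)) hD (A ω₀) d (M.kU t d ω₀)
  refine M.tail (T - (t + 1)) (t + 1) (by omega) _
    (dI.mono (by omega) (by omega) le_rfl) ?_
  simp only [M.F_succ, ← mul_assoc]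
  have d2 := (dI.mul ((M.dep_F t).mono le_rfl le_rfl (Nat.le_succ _))).mul
      ((M.dep_kU' t).mono (Nat.zero_le _) le_rfl le_rfl)
  have d3 := (d2.mono (Nat.le_succ _) le_rfl le_rfl).mul
      ((M.dep_kX' t).mono le_rfl (Nat.zero_le _) le_rfl)
  refine M.elimY _ d3 le_rfl (M.elimX _ d2 le_rfl ?_)
  exact kernel_ci (updU t) (fun ω => ω.2.2 t) (updU_1 t) (updU_2 t) (M.kU t)
    (fun v => (M.dep_kU t v).updU t le_rfl) (fun _ => M.pol_sum _ _ _) (M.F t)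
    ((M.dep_F t).updU t le_rfl) A (hA.updU t le_rfl) d ω₀ (fun ω h => hk d ω ω₀ h)

lemma CHMM.condEnt_X (M : CHMM T X Y U) (t : Fin T) {α : Type*} [Fintype α] [DecidableEq α]
    (A : Traj T X Y U → α) (hA : Dep (t + 1) (t + 1) (t + 1) A)
    (hk : ∀ d ω ω', A ω = A ω' → M.kX t d ω = M.kX t d ω') :
    M.condEnt (fun ω => ω.1 t.succ) A = -∑ ω, M.p ω * Real.log (M.kX t (ω.1 t.succ) ω) := by
  apply M.condEnt_kernel
  intro d ω₀
  have hD : Dep (t + 2) (t + 1) (t + 1) (fun ω : Traj T X Y U => ω.1 t.succ) :=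
    fun ω ω' h => h.1 t.succ (by simp)
  have dI := dep_ind (hA.mono (Nat.le_succ _) le_rfl le_rfl) hD (A ω₀) d (M.kX t d ω₀)
  refine M.tail (T - (t + 1)) (t + 1) (by omega) _
    (dI.mono (by omega) (by omega) le_rfl) ?_
  simp only [M.F_succ, ← mul_assoc]
  have dW := ((M.dep_F t).mono le_rfl le_rfl (Nat.le_succ _)).mul
      ((M.dep_kU' t).mono (Nat.zero_le _) le_rfl le_rfl)
  have d2 := (dI.mul ((M.dep_F t).mono (Nat.le_succ _) le_rfl (Nat.le_succ _))).mul
      ((M.dep_kU' t).mono (Nat.zero_le _) le_rfl le_rfl)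
  have d3 := d2.mul ((M.dep_kX' t).mono le_rfl (Nat.zero_le _) le_rfl)
  refine M.elimY _ d3 le_rfl ?_
  have := kernel_ci (updX t.succ) (fun ω => ω.1 t.succ) (updX_1 _) (updX_2 _) (M.kX t)
    (fun v => (M.dep_kX t v).updX t.succ (by simp)) (fun _ => M.f_sum _ _ _)
    (fun ω => M.F t ω * M.kU t (ω.2.2 t) ω)
    (dW.updX t.succ (by simp)) A (hA.updX t.succ (by simp)) d ω₀ (fun ω h => hk d ω ω₀ h)
  simpa only [← mul_assoc] using this

lemma CHMM.condEnt_Y (M : CHMM T X Y U) (t : Fin T) {α : Type*} [Fintype α] [DecidableEq α]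
    (A : Traj T X Y U → α) (hA : Dep (t + 2) (t + 1) (t + 1) A)
    (hk : ∀ d ω ω', A ω = A ω' → M.kY t d ω = M.kY t d ω') :
    M.condEnt (fun ω => ω.2.1 t.succ) A
      = -∑ ω, M.p ω * Real.log (M.kY t (ω.2.1 t.succ) ω) := by
  apply M.condEnt_kernel
  intro d ω₀
  have hD : Dep (t + 2) (t + 2) (t + 1) (fun ω : Traj T X Y U => ω.2.1 t.succ) :=
    fun ω ω' h => h.2.1 t.succ (by simp)
  have dI := dep_ind (hA.mono le_rfl (Nat.le_succ _) le_rfl) hD (A ω₀) d (M.kY t d ω₀)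
  refine M.tail (T - (t + 1)) (t + 1) (by omega) _
    (dI.mono (by omega) (by omega) le_rfl) ?_
  simp only [M.F_succ, ← mul_assoc]
  have dW := (((M.dep_F t).mono (Nat.le_succ _) le_rfl (Nat.le_succ _)).mul
      ((M.dep_kU' t).mono (Nat.zero_le _) le_rfl le_rfl)).mul
      ((M.dep_kX' t).mono le_rfl (Nat.zero_le _) le_rfl)
  have := kernel_ci (updY t.succ) (fun ω => ω.2.1 t.succ) (updY_1 _) (updY_2 _) (M.kY t)
    (fun v => (M.dep_kY t v).updY t.succ (by simp)) (fun _ => M.g_sum _ _ _)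
    (fun ω => M.F t ω * M.kU t (ω.2.2 t) ω * M.kX t (ω.1 t.succ) ω)
    (dW.updY t.succ (by simp)) A (hA.updY t.succ (by simp)) d ω₀ (fun ω h => hk d ω ω₀ h)
  simpa only [← mul_assoc] using this

lemma Xpref_eq_iff (n : ℕ) (h : n ≤ T + 1) (ω ω' : Traj T X Y U) :
    Xpref T n h ω = Xpref T n h ω' ↔ ∀ i : Fin (T + 1), (i : ℕ) < n → ω.1 i = ω'.1 i := by
  constructor
  · intro e i hi
    exact congrFun e ⟨i, hi⟩
  · intro e
    funext i
    exact e _ i.isLt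

lemma Ypref_eq_iff (n : ℕ) (h : n ≤ T + 1) (ω ω' : Traj T X Y U) :
    Ypref T n h ω = Ypref T n h ω' ↔ ∀ i : Fin (T + 1), (i : ℕ) < n → ω.2.1 i = ω'.2.1 i := by
  constructor
  · intro e i hi
    exact congrFun e ⟨i, hi⟩
  · intro e
    funext i
    exact e _ i.isLt

lemma Upref_eq_iff (n : ℕ) (h : n ≤ T) (ω ω' : Traj T X Y U) :
    Upref T n h ω = Upref T n h ω' ↔ ∀ i : Fin T, (i : ℕ) < n → ω.2.2 i = ω'.2.2 i := by
  constructor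
  · intro e i hi
    exact congrFun e ⟨i, hi⟩
  · intro e
    funext i
    exact e _ i.isLt

lemma forall_fin_succ_iff {N n : ℕ} (h : n < N) (P : Fin N → Prop) :
    (∀ i : Fin N, (i : ℕ) < n + 1 → P i) ↔ (∀ i : Fin N, (i : ℕ) < n → P i) ∧ P ⟨n, h⟩ := by
  constructor
  · intro e
    exact ⟨fun i hi => e i (by omega), e ⟨n, h⟩ (by simp)⟩
  · rintro ⟨e, e'⟩ i hi
    rcases Nat.lt_succ_iff_lt_or_eq.1 hi with hi | hi
    · exact e i hi
    · obtain rfl : i = ⟨n, h⟩ := Fin.ext hi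
      exact e'

lemma CHMM.step (M : CHMM T X Y U) (n : ℕ) (hn : n < T) :
    M.condEnt (Xpref T (n + 1 + 1) (by omega))
        (fun ω => (Ypref T (n + 1 + 1) (by omega) ω, Upref T (n + 1) (by omega) ω)) =
    M.condEnt (Xpref T (n + 1) (by omega))
        (fun ω => (Ypref T (n + 1) (by omega) ω, Upref T n (by omega) ω)) +
      (M.condEnt (Xat T (n + 1) (by omega))
              (fun ω => (Ypref T (n + 1 + 1) (by omega) ω, Upref T (n + 1) (by omega) ω))
            - M.condEnt (Xat T (n + 1) (by omega))
              (fun ω => (Ypref T (n + 1) (by omega) ω, Upref T (n + 1) (by omega) ω))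
            + M.condEnt (Xat T (n + 1) (by omega))
              (fun ω => (Xat T n (by omega) ω,
                Ypref T (n + 1) (by omega) ω, Upref T (n + 1) (by omega) ω))) := by
  let t : Fin T := ⟨n, hn⟩
  let Xn : Traj T X Y U → _ := Xpref T (n + 1) (by omega)
  let Xn' : Traj T X Y U → _ := Xpref T (n + 1 + 1) (by omega)
  let Yn : Traj T X Y U → _ := Ypref T (n + 1) (by omega)
  let Yn' : Traj T X Y U → _ := Ypref T (n + 1 + 1) (by omega)
  let Un : Traj T X Y U → _ := Upref T n (by omega)
  let Un' : Traj T X Y U → _ := Upref T (n + 1) (by omega)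
  let x : Traj T X Y U → _ := Xat T n (by omega)
  let x' : Traj T X Y U → _ := Xat T (n + 1) (by omega)
  have hXn : ∀ ω ω', Xn ω = Xn ω' ↔ _ := Xpref_eq_iff (n + 1) (by omega)
  have hYn : ∀ ω ω', Yn ω = Yn ω' ↔ _ := Ypref_eq_iff (n + 1) (by omega)
  have hUn : ∀ ω ω', Un ω = Un ω' ↔ _ := Upref_eq_iff n (by omega)
  have hXn' : ∀ ω ω', Xn' ω = Xn' ω' ↔ Xn ω = Xn ω' ∧ x' ω = x' ω' := fun ω ω' => by
    rw [hXn, Xpref_eq_iff, forall_fin_succ_iff (n := n + 1) (by omega)]; rfl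
  have hYn' : ∀ ω ω', Yn' ω = Yn' ω' ↔ Yn ω = Yn ω' ∧ ω.2.1 t.succ = ω'.2.1 t.succ :=
      fun ω ω' => by
    rw [hYn, Ypref_eq_iff, forall_fin_succ_iff (n := n + 1) (by omega)]; rfl
  have hUn' : ∀ ω ω', Un' ω = Un' ω' ↔ Un ω = Un ω' ∧ ω.2.2 t = ω'.2.2 t :=
      fun ω ω' => by
    rw [hUn, Upref_eq_iff, forall_fin_succ_iff (n := n) (by omega)]
  have hx : ∀ ω ω', Xn ω = Xn ω' → x ω = x ω' := fun ω ω' h =>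
    (hXn ω ω').1 h _ (by simp)
  have dX : Dep (n + 1) 0 0 Xn := fun ω ω' h => (hXn _ _).2 h.1
  have dx : Dep (n + 1) 0 0 x := fun ω ω' h => h.1 _ (by simp)
  have dx' : Dep (n + 2) 0 0 x' := fun ω ω' h => h.1 _ (by simp)
  have dX' : Dep (n + 2) 0 0 Xn' := fun ω ω' h => (Xpref_eq_iff _ _ _ _).2 h.1
  have dY : Dep 0 (n + 1) 0 Yn := fun ω ω' h => (hYn _ _).2 h.2.1
  have dU : Dep 0 0 n Un := fun ω ω' h => (hUn _ _).2 h.2.2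
  have dU' : Dep 0 0 (n + 1) Un' := fun ω ω' h => (Upref_eq_iff _ _ _ _).2 h.2.2
  have kUh : ∀ d ω ω', Yn ω = Yn ω' → Un ω = Un ω' → M.kU t d ω = M.kU t d ω' :=
    fun d ω ω' h1 h2 => M.dep_kU t d _ _ ⟨fun i hi => by omega, (hYn _ _).1 h1, (hUn _ _).1 h2⟩
  have kXh : ∀ d ω ω', x ω = x ω' → Un' ω = Un' ω' → M.kX t d ω = M.kX t d ω' := by
    intro d ω ω' h1 h2
    have h3 := ((hUn' _ _).1 h2).2
    have h1' : ω.1 t.castSucc = ω'.1 t.castSucc := h1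
    simp only [CHMM.kX, h1', h3]
  have kYh : ∀ d ω ω', x' ω = x' ω' → Un' ω = Un' ω' → M.kY t d ω = M.kY t d ω' := by
    intro d ω ω' h1 h2
    have h3 := ((hUn' _ _).1 h2).2
    have h1' : ω.1 t.succ = ω'.1 t.succ := h1
    simp only [CHMM.kY, h1', h3]
  have e1 : M.condEnt (fun ω => ω.2.2 t) (fun ω => (Xn ω, Yn ω, Un ω))
      = M.condEnt (fun ω => ω.2.2 t) (fun ω => (Yn ω, Un ω)) := by
    rw [M.condEnt_U t, M.condEnt_U t]
    · exact fun ω ω' h => by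
        rw [dY.mono (Nat.zero_le _) le_rfl (Nat.zero_le _) ω ω' h,
          dU.mono (Nat.zero_le _) (Nat.zero_le _) le_rfl ω ω' h]
    · intro d ω ω' h
      simp only [Prod.mk.injEq] at h
      exact kUh d ω ω' h.1 h.2
    · exact fun ω ω' h => by
        rw [dX.mono le_rfl (Nat.zero_le _) (Nat.zero_le _) ω ω' h,
          dY.mono (Nat.zero_le _) le_rfl (Nat.zero_le _) ω ω' h,
          dU.mono (Nat.zero_le _) (Nat.zero_le _) le_rfl ω ω' h]
    · intro d ω ω' h
      simp only [Prod.mk.injEq] at h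
      exact kUh d ω ω' h.2.1 h.2.2
  have e2 : M.condEnt x' (fun ω => (Xn ω, Yn ω, Un' ω))
      = M.condEnt x' (fun ω => (x ω, Yn ω, Un' ω)) := by
    refine (M.condEnt_X t _ ?_ ?_).trans (M.condEnt_X t _ ?_ ?_).symm
    · exact fun ω ω' h => by
        rw [dX.mono le_rfl (Nat.zero_le _) (Nat.zero_le _) ω ω' h,
          dY.mono (Nat.zero_le _) le_rfl (Nat.zero_le _) ω ω' h,
          dU'.mono (Nat.zero_le _) (Nat.zero_le _) le_rfl ω ω' h]
    · intro d ω ω' h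
      simp only [Prod.mk.injEq] at h
      exact kXh d ω ω' (hx _ _ h.1) h.2.2
    · exact fun ω ω' h => by
        rw [dx.mono le_rfl (Nat.zero_le _) (Nat.zero_le _) ω ω' h,
          dY.mono (Nat.zero_le _) le_rfl (Nat.zero_le _) ω ω' h,
          dU'.mono (Nat.zero_le _) (Nat.zero_le _) le_rfl ω ω' h]
    · intro d ω ω' h
      simp only [Prod.mk.injEq] at h
      exact kXh d ω ω' h.1 h.2.2
  have e3 : M.condEnt (fun ω => ω.2.1 t.succ) (fun ω => (Xn' ω, Yn ω, Un' ω))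
      = M.condEnt (fun ω => ω.2.1 t.succ) (fun ω => (x' ω, Yn ω, Un' ω)) := by
    rw [M.condEnt_Y t, M.condEnt_Y t]
    · exact fun ω ω' h => by
        rw [dx'.mono le_rfl (Nat.zero_le _) (Nat.zero_le _) ω ω' h,
          dY.mono (Nat.zero_le _) le_rfl (Nat.zero_le _) ω ω' h,
          dU'.mono (Nat.zero_le _) (Nat.zero_le _) le_rfl ω ω' h]
    · intro d ω ω' h
      simp only [Prod.mk.injEq] at h
      exact kYh d ω ω' h.1 h.2.2
    · exact fun ω ω' h => by
        rw [dX'.mono le_rfl (Nat.zero_le _) (Nat.zero_le _) ω ω' h,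
          dY.mono (Nat.zero_le _) le_rfl (Nat.zero_le _) ω ω' h,
          dU'.mono (Nat.zero_le _) (Nat.zero_le _) le_rfl ω ω' h]
    · intro d ω ω' h
      simp only [Prod.mk.injEq] at h
      exact kYh d ω ω' ((hXn' _ _).1 h.1).2 h.2.2
  change M.condEnt Xn' (fun ω => (Yn' ω, Un' ω)) = M.condEnt Xn (fun ω => (Yn ω, Un ω)) +
    (M.condEnt x' (fun ω => (Yn' ω, Un' ω)) - M.condEnt x' (fun ω => (Yn ω, Un' ω))
      + M.condEnt x' (fun ω => (x ω, Yn ω, Un' ω)))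
  rw [← e2]
  clear_value Xn Xn' Yn Yn' Un Un' x x'
  simp only [M.condEnt_sub] at e1 e3 ⊢
  have c1 : M.entropy (fun ω => (ω.2.2 t, Xn ω, Yn ω, Un ω))
      = M.entropy (fun ω => (Xn ω, Yn ω, Un' ω)) := by
    apply M.entropy_congr; intro ω ω'; simp only [Prod.mk.injEq, hUn']; tauto
  have c2 : M.entropy (fun ω => (ω.2.2 t, Yn ω, Un ω))
      = M.entropy (fun ω => (Yn ω, Un' ω)) := by
    apply M.entropy_congr; intro ω ω'; simp only [Prod.mk.injEq, hUn']; tauto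
  have c3 : M.entropy (fun ω => (ω.2.1 t.succ, Xn' ω, Yn ω, Un' ω))
      = M.entropy (fun ω => (Xn' ω, Yn' ω, Un' ω)) := by
    apply M.entropy_congr; intro ω ω'; simp only [Prod.mk.injEq, hXn', hYn']; tauto
  have c4 : M.entropy (fun ω => (ω.2.1 t.succ, x' ω, Yn ω, Un' ω))
      = M.entropy (fun ω => (x' ω, Yn' ω, Un' ω)) := by
    apply M.entropy_congr; intro ω ω'; simp only [Prod.mk.injEq, hYn']; tauto
  have c5 : M.entropy (fun ω => (Xn' ω, Yn ω, Un' ω))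
      = M.entropy (fun ω => (x' ω, Xn ω, Yn ω, Un' ω)) := by
    apply M.entropy_congr; intro ω ω'; simp only [Prod.mk.injEq, hXn']; tauto
  rw [c1, c2] at e1
  rw [c3, c4, c5] at e3
  linarith

lemma CHMM.base (M : CHMM T X Y U) :
    M.condEnt (Xpref T (0 + 1) (by omega))
        (fun ω => (Ypref T (0 + 1) (by omega) ω, Upref T 0 (by omega) ω)) =
    M.condEnt (Xat T 0 (by omega)) (Yat T 0 (by omega)) := by
  have hX : ∀ ω ω' : Traj T X Y U, Xpref T (0 + 1) (by omega) ω = Xpref T (0 + 1) (by omega) ω'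
      ↔ Xat T 0 (by omega) ω = Xat T 0 (by omega) ω' := fun ω ω' => by
    rw [Xpref_eq_iff, forall_fin_succ_iff (n := 0) (by omega)]; simp [Xat]
  have hY : ∀ ω ω' : Traj T X Y U, Ypref T (0 + 1) (by omega) ω = Ypref T (0 + 1) (by omega) ω'
      ↔ Yat T 0 (by omega) ω = Yat T 0 (by omega) ω' := fun ω ω' => by
    rw [Ypref_eq_iff, forall_fin_succ_iff (n := 0) (by omega)]; simp [Yat]
  have hU : ∀ ω ω' : Traj T X Y U, Upref T 0 (by omega) ω = Upref T 0 (by omega) ω' :=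
    fun ω ω' => by rw [Upref_eq_iff]; intro i hi; omega
  rw [M.condEnt_sub, M.condEnt_sub]
  congr 1
  · apply M.entropy_congr; intro ω ω'
    simp only [Prod.mk.injEq, hX, hY]
    simp [hU ω ω']
  · apply M.entropy_congr; intro ω ω'
    simp only [Prod.mk.injEq, hY]
    simp [hU ω ω']

lemma CHMM.telescope (M : CHMM T X Y U) (term : Fin (T + 1) → ℝ)
    (h0 : term 0 = M.condEnt (Xpref T (0 + 1) (by omega))
        (fun ω => (Ypref T (0 + 1) (by omega) ω, Upref T 0 (by omega) ω)))
    (hs : ∀ (n : ℕ) (hn : n < T), M.condEnt (Xpref T (n + 1 + 1) (by omega))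
        (fun ω => (Ypref T (n + 1 + 1) (by omega) ω, Upref T (n + 1) (by omega) ω)) =
      M.condEnt (Xpref T (n + 1) (by omega))
        (fun ω => (Ypref T (n + 1) (by omega) ω, Upref T n (by omega) ω)) +
      term ⟨n + 1, by omega⟩) (n : ℕ) :
    ∀ (hn : n ≤ T), M.condEnt (Xpref T (n + 1) (by omega))
        (fun ω => (Ypref T (n + 1) (by omega) ω, Upref T n (by omega) ω)) =
      ∑ t : Fin (n + 1), term (Fin.castLE (by omega) t) := by
  induction n with
  | zero => intro hn; rw [← h0]; simp
  | succ n ih =>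
    intro hn
    rw [hs n (by omega), ih (by omega), Fin.sum_univ_castSucc (n := n + 1)]
    rfl

/-- Additive decomposition of the smoother entropy
`H(X^T | Y^T, U^{T-1}) = ∑_{t=0}^{T} [H(X_t | Y^t, U^{t-1}) − H(X_t | Y^{t-1}, U^{t-1})
  + H(X_t | X_{t-1}, Y^{t-1}, U^{t-1})]`,
with the `t = 0` terms interpreted as `H(X_0 | Y_0)`, `H(X_0)`, `H(X_0)`. -/
theorem smoother_entropy_additive_decomposition
    {T : ℕ} {X Y U : Type*} [Fintype X] [Fintype Y] [Fintype U]
    [DecidableEq X] [DecidableEq Y] [DecidableEq U]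
    (hT : 1 ≤ T) (M : CHMM T X Y U) :
    M.condEnt (Xpref T (T + 1) le_rfl)
        (fun ω => (Ypref T (T + 1) le_rfl ω, Upref T T le_rfl ω)) =
      ∑ t : Fin (T + 1),
        if h0 : (t : ℕ) = 0 then
          M.condEnt (Xat T 0 (by omega)) (Yat T 0 (by omega))
            - M.entropy (Xat T 0 (by omega)) + M.entropy (Xat T 0 (by omega))
        else
          M.condEnt (Xat T t t.isLt)
              (fun ω => (Ypref T ((t : ℕ) + 1) (by have := t.isLt; omega) ω,
                Upref T (t : ℕ) (by have := t.isLt; omega) ω))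
            - M.condEnt (Xat T t t.isLt)
              (fun ω => (Ypref T (t : ℕ) (by have := t.isLt; omega) ω,
                Upref T (t : ℕ) (by have := t.isLt; omega) ω))
            + M.condEnt (Xat T t t.isLt)
              (fun ω => (Xat T ((t : ℕ) - 1) (by have := t.isLt; omega) ω,
                Ypref T (t : ℕ) (by have := t.isLt; omega) ω,
                Upref T (t : ℕ) (by have := t.isLt; omega) ω)) := by
  refine (M.telescope (fun t : Fin (T + 1) =>
        if h0 : (t : ℕ) = 0 then
          M.condEnt (Xat T 0 (by omega)) (Yat T 0 (by omega))
            - M.entropy (Xat T 0 (by omega)) + M.entropy (Xat T 0 (by omega))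
        else
          M.condEnt (Xat T t t.isLt)
              (fun ω => (Ypref T ((t : ℕ) + 1) (by have := t.isLt; omega) ω,
                Upref T (t : ℕ) (by have := t.isLt; omega) ω))
            - M.condEnt (Xat T t t.isLt)
              (fun ω => (Ypref T (t : ℕ) (by have := t.isLt; omega) ω,
                Upref T (t : ℕ) (by have := t.isLt; omega) ω))
            + M.condEnt (Xat T t t.isLt)
              (fun ω => (Xat T ((t : ℕ) - 1) (by have := t.isLt; omega) ω,
                Ypref T (t : ℕ) (by have := t.isLt; omega) ω,
                Upref T (t : ℕ) (by have := t.isLt; omega) ω))) ?_ ?_ T le_rfl).trans ?_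
  · rw [M.base]
    simp
  · intro n hn
    rw [M.step n hn]
    simp
  · rfl
end

section
/- In any controlled hidden Markov model with output-feedback policy over horizon T ≥ 1, the smoother entropy satisfies H(X^T | Y^T, U^{T-1}) = E_{Y^T, U^{T-1}} [ ∑_{t=0}^{T} ( h(X_t | y^t, u^{t-1}) − h(X_t | y^{t-1}, u^{t-1}) + h(X_t | X_{t-1}, y^{t-1}, u^{t-1}) ) ], where the expectation is over realizations (y^T, u^{T-1}) with positive probability weighted by their probabilities, and the t = 0 terms are interpreted as h(X_0 | y^0, u^{-1}) = h(X_0 | y_0), h(X_0 | y^{-1}, u^{-1}) = h(X_0 | X_{-1}, y^{-1}, u^{-1}) = H(X_0). -/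
open Finset

variable {T : ℕ} {X Y U : Type*} [Fintype X] [Fintype Y] [Fintype U]
  [DecidableEq X] [DecidableEq Y] [DecidableEq U]

namespace SmootherAux

set_option linter.unusedSectionVars false

/-- `F` depends only on the first `a` states, `b` measurements, `c` controls. -/
def Dep {T : ℕ} {X Y U : Type*} {β : Type*} (a b c : ℕ) (F : Traj T X Y U → β) : Prop :=
  ∀ ω ω' : Traj T X Y U, (∀ i : Fin (T + 1), (i : ℕ) < a → ω.1 i = ω'.1 i) →
    (∀ i : Fin (T + 1), (i : ℕ) < b → ω.2.1 i = ω'.2.1 i) →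
    (∀ i : Fin T, (i : ℕ) < c → ω.2.2 i = ω'.2.2 i) → F ω = F ω'

theorem Dep.mono {T : ℕ} {X Y U : Type*} {β : Type*} {a b c a' b' c' : ℕ}
    {F : Traj T X Y U → β} (h : Dep a b c F) (ha : a ≤ a') (hb : b ≤ b') (hc : c ≤ c') :
    Dep a' b' c' F := fun ω ω' h1 h2 h3 =>
  h ω ω' (fun i hi => h1 i (by omega)) (fun i hi => h2 i (by omega)) (fun i hi => h3 i (by omega))

theorem Dep.mul {T : ℕ} {X Y U : Type*} {a b c : ℕ}
    {F G : Traj T X Y U → ℝ} (h : Dep a b c F) (h' : Dep a b c G) :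
    Dep a b c (fun ω => F ω * G ω) := fun ω ω' h1 h2 h3 => by
  simp only [h ω ω' h1 h2 h3, h' ω ω' h1 h2 h3]

theorem resample {Ω A : Type*} [Fintype Ω] [Fintype A] (c : Ω → A) (upd : Ω → A → Ω)
    (h1 : ∀ ω a, c (upd ω a) = a) (h2 : ∀ ω, upd ω (c ω) = ω)
    (h3 : ∀ ω a b, upd (upd ω a) b = upd ω b) (H : Ω → ℝ) :
    ∑ ω, H ω = (Fintype.card A : ℝ)⁻¹ * ∑ ω, ∑ a, H (upd ω a) := by
  rcases isEmpty_or_nonempty Ω with hΩ | ⟨⟨ω0⟩⟩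
  · simp
  have hA : (Fintype.card A : ℝ) ≠ 0 := by
    have : Nonempty A := ⟨c ω0⟩
    exact_mod_cast Fintype.card_ne_zero
  have key : ∑ q : Ω × A, H (upd q.1 q.2) = ∑ q : Ω × A, H q.1 := by
    refine Fintype.sum_equiv
      { toFun := fun q => (upd q.1 q.2, c q.1)
        invFun := fun q => (upd q.1 q.2, c q.1)
        left_inv := fun q => by simp [h1, h2, h3]
        right_inv := fun q => by simp [h1, h2, h3] } _ _ (fun q => rfl)
  rw [Fintype.sum_prod_type, Fintype.sum_prod_type] at key
  rw [key]
  simp only [sum_const, card_univ, nsmul_eq_mul, ← mul_sum]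
  field_simp

theorem step_const {Ω A : Type*} [Fintype Ω] [Fintype A] (c : Ω → A) (upd : Ω → A → Ω)
    (h1 : ∀ ω a, c (upd ω a) = a) (h2 : ∀ ω, upd ω (c ω) = ω)
    (h3 : ∀ ω a b, upd (upd ω a) b = upd ω b) (G : Ω → ℝ) (k : A → Ω → ℝ)
    (hG : ∀ ω a, G (upd ω a) = G ω) (hk : ∀ b ω a, k b (upd ω a) = k b ω)
    (hs : ∀ ω, ∑ a, k a ω = 1) :
    ∑ ω, G ω * k (c ω) ω = (Fintype.card A : ℝ)⁻¹ * ∑ ω, G ω := by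
  rw [resample c upd h1 h2 h3]
  simp only [h1, hG, hk, ← mul_sum, hs, mul_one]

theorem step_ind {Ω A : Type*} [Fintype Ω] [Fintype A] [DecidableEq A]
    (c : Ω → A) (upd : Ω → A → Ω)
    (h1 : ∀ ω a, c (upd ω a) = a) (h2 : ∀ ω, upd ω (c ω) = ω)
    (h3 : ∀ ω a b, upd (upd ω a) b = upd ω b) (G : Ω → ℝ) (k : A → Ω → ℝ)
    (hG : ∀ ω a, G (upd ω a) = G ω) (hk : ∀ b ω a, k b (upd ω a) = k b ω)
    (hs : ∀ ω, ∑ a, k a ω = 1) (a0 : A) :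
    ∑ ω, G ω * k (c ω) ω * (if c ω = a0 then 1 else 0) =
      ∑ ω, G ω * k (c ω) ω * k a0 ω := by
  rw [resample c upd h1 h2 h3, resample c upd h1 h2 h3 (fun ω => G ω * k (c ω) ω * k a0 ω)]
  simp only [h1, hG, hk, ← mul_sum, ← sum_mul, hs, mul_one]
  simp

section
variable {T : ℕ} {X Y U : Type*} [Fintype X] [Fintype Y] [Fintype U]
  [DecidableEq X] [DecidableEq Y] [DecidableEq U]

def updX (i : Fin (T + 1)) (ω : Traj T X Y U) (a : X) : Traj T X Y U :=
  (Function.update ω.1 i a, ω.2.1, ω.2.2)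
def updY (i : Fin (T + 1)) (ω : Traj T X Y U) (a : Y) : Traj T X Y U :=
  (ω.1, Function.update ω.2.1 i a, ω.2.2)
def updU (i : Fin T) (ω : Traj T X Y U) (a : U) : Traj T X Y U :=
  (ω.1, ω.2.1, Function.update ω.2.2 i a)

theorem Dep.updX {β : Type*} {a b c : ℕ} {F : Traj T X Y U → β} (h : Dep a b c F)
    (i : Fin (T + 1)) (hi : a ≤ i) (ω : Traj T X Y U) (x : X) :
    F (updX i ω x) = F ω :=
  h _ _ (fun j hj => Function.update_of_ne (by rintro rfl; omega) _ _)
    (fun _ _ => rfl) (fun _ _ => rfl)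
theorem Dep.updY {β : Type*} {a b c : ℕ} {F : Traj T X Y U → β} (h : Dep a b c F)
    (i : Fin (T + 1)) (hi : b ≤ i) (ω : Traj T X Y U) (x : Y) :
    F (updY i ω x) = F ω :=
  h _ _ (fun _ _ => rfl) (fun j hj => Function.update_of_ne (by rintro rfl; omega) _ _)
    (fun _ _ => rfl)
theorem Dep.updU {β : Type*} {a b c : ℕ} {F : Traj T X Y U → β} (h : Dep a b c F)
    (i : Fin T) (hi : c ≤ i) (ω : Traj T X Y U) (x : U) :
    F (updU i ω x) = F ω :=
  h _ _ (fun _ _ => rfl) (fun _ _ => rfl)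
    (fun j hj => Function.update_of_ne (by rintro rfl; omega) _ _)

/-- Partial products. -/
noncomputable def J (M : CHMM T X Y U) (n : ℕ) (ω : Traj T X Y U) : ℝ :=
  M.p0 (ω.1 0) * M.g0 (ω.2.1 0) (ω.1 0) *
    ∏ t ∈ univ.filter (fun t : Fin T => (t : ℕ) < n),
      (M.pol t (ω.2.2 t) ω.2.1 ω.2.2 *
        M.f t (ω.1 t.succ) (ω.1 t.castSucc) (ω.2.2 t) *
        M.g t (ω.2.1 t.succ) (ω.1 t.succ) (ω.2.2 t))

theorem J_top (M : CHMM T X Y U) (ω : Traj T X Y U) : J M T ω = M.p ω := by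
  simp [J, CHMM.p]

theorem J_dep (M : CHMM T X Y U) (n : ℕ) : Dep (n + 1) (n + 1) n (J M n) := by
  intro ω ω' h1 h2 h3
  unfold J
  rw [h1 0 (by simp), h2 0 (by simp)]
  congr 1
  refine prod_congr rfl fun t ht => ?_
  have ht : (t : ℕ) < n := by simpa using ht
  rw [h3 t ht, h1 t.succ (by simp; omega), h2 t.succ (by simp; omega),
    h1 t.castSucc (by simp; omega),
    M.pol_causal t _ ω.2.1 ω'.2.1 ω.2.2 ω'.2.2 (fun i hi => h2 i (by omega))
      (fun i hi => h3 i (by omega))]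

theorem J_succ (M : CHMM T X Y U) (t : Fin T) (ω : Traj T X Y U) :
    J M (t + 1) ω = J M t ω * M.pol t (ω.2.2 t) ω.2.1 ω.2.2 *
        M.f t (ω.1 t.succ) (ω.1 t.castSucc) (ω.2.2 t) *
        M.g t (ω.2.1 t.succ) (ω.1 t.succ) (ω.2.2 t) := by
  unfold J
  have : univ.filter (fun s : Fin T => (s : ℕ) < t + 1) =
      insert t (univ.filter (fun s : Fin T => (s : ℕ) < t)) := by
    ext s; simp [Fin.ext_iff]; omega
  rw [this, prod_insert (by simp)]
  ring

noncomputable def kU (M : CHMM T X Y U) (t : Fin T) (a : U) (ω : Traj T X Y U) : ℝ :=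
  M.pol t a ω.2.1 ω.2.2
noncomputable def kX (M : CHMM T X Y U) (t : Fin T) (a : X) (ω : Traj T X Y U) : ℝ :=
  M.f t a (ω.1 t.castSucc) (ω.2.2 t)
noncomputable def kY (M : CHMM T X Y U) (t : Fin T) (a : Y) (ω : Traj T X Y U) : ℝ :=
  M.g t a (ω.1 t.succ) (ω.2.2 t)

theorem kU_dep (M : CHMM T X Y U) (t : Fin T) (a : U) : Dep 0 (t + 1) t (kU M t a) :=
  fun ω ω' _ h2 h3 => M.pol_causal t a _ _ _ _ (fun i hi => h2 i (by omega)) h3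
theorem kX_dep (M : CHMM T X Y U) (t : Fin T) (a : X) : Dep (t + 1) 0 (t + 1) (kX M t a) :=
  fun ω ω' h1 _ h3 => by
    unfold kX; rw [h1 t.castSucc (by simp), h3 t (by simp)]
theorem kY_dep (M : CHMM T X Y U) (t : Fin T) (a : Y) : Dep (t + 2) 0 (t + 1) (kY M t a) :=
  fun ω ω' h1 _ h3 => by
    unfold kY; rw [h1 t.succ (by simp), h3 t (by simp)]
theorem kU_dep' (M : CHMM T X Y U) (t : Fin T) :
    Dep 0 (t + 1) (t + 1) (fun ω => kU M t (ω.2.2 t) ω) :=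
  fun ω ω' h1 h2 h3 => by
    simp only [h3 t (by simp)]
    exact kU_dep M t _ ω ω' h1 h2 (fun i hi => h3 i (by omega))
theorem kX_dep' (M : CHMM T X Y U) (t : Fin T) :
    Dep (t + 2) 0 (t + 1) (fun ω => kX M t (ω.1 t.succ) ω) :=
  fun ω ω' h1 h2 h3 => by
    simp only [h1 t.succ (by simp)]
    exact kX_dep M t _ ω ω' (fun i hi => h1 i (by omega)) h2 h3

noncomputable def J1 (M : CHMM T X Y U) (t : Fin T) (ω : Traj T X Y U) : ℝ :=
  J M t ω * kU M t (ω.2.2 t) ω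
noncomputable def J2 (M : CHMM T X Y U) (t : Fin T) (ω : Traj T X Y U) : ℝ :=
  J1 M t ω * kX M t (ω.1 t.succ) ω
theorem J3 (M : CHMM T X Y U) (t : Fin T) (ω : Traj T X Y U) :
  J M (t + 1) ω = J2 M t ω * kY M t (ω.2.1 t.succ) ω := J_succ M t ω

theorem J1_dep (M : CHMM T X Y U) (t : Fin T) : Dep (t + 1) (t + 1) (t + 1) (J1 M t) :=
  ((J_dep M t).mono le_rfl le_rfl (by omega)).mul
    ((kU_dep' M t).mono (by omega) (by omega) (by omega))
theorem J2_dep (M : CHMM T X Y U) (t : Fin T) : Dep (t + 2) (t + 1) (t + 1) (J2 M t) :=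
  ((J1_dep M t).mono (by omega) le_rfl (by omega)).mul
    ((kX_dep' M t).mono (by omega) (by omega) (by omega))

theorem sumU (M : CHMM T X Y U) (t : Fin T) (F : Traj T X Y U → ℝ)
    (hF : Dep (t + 1) (t + 1) t F) :
    ∑ ω, F ω * J1 M t ω = (Fintype.card U : ℝ)⁻¹ * ∑ ω, F ω * J M t ω := by
  have := step_const (fun ω : Traj T X Y U => ω.2.2 t) (updU t) (by simp [updU])
    (by simp [updU]) (by simp [updU]) (fun ω => F ω * J M t ω) (kU M t)
    ((hF.mul (J_dep M t)).updU t le_rfl) (fun b => (kU_dep M t b).updU t le_rfl)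
    (fun ω => M.pol_sum _ _ _)
  simpa only [J1, mul_assoc] using this
theorem sumX (M : CHMM T X Y U) (t : Fin T) (F : Traj T X Y U → ℝ)
    (hF : Dep (t + 1) (t + 1) (t + 1) F) :
    ∑ ω, F ω * J2 M t ω = (Fintype.card X : ℝ)⁻¹ * ∑ ω, F ω * J1 M t ω := by
  have := step_const (fun ω : Traj T X Y U => ω.1 t.succ) (updX t.succ) (by simp [updX])
    (by simp [updX]) (by simp [updX]) (fun ω => F ω * J1 M t ω) (kX M t)
    ((hF.mul (J1_dep M t)).updX t.succ (by simp)) (fun b => (kX_dep M t b).updX t.succ (by simp))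
    (fun ω => M.f_sum _ _ _)
  simpa only [J2, mul_assoc] using this
theorem sumY (M : CHMM T X Y U) (t : Fin T) (F : Traj T X Y U → ℝ)
    (hF : Dep (t + 2) (t + 1) (t + 1) F) :
    ∑ ω, F ω * J M (t + 1) ω = (Fintype.card Y : ℝ)⁻¹ * ∑ ω, F ω * J2 M t ω := by
  have := step_const (fun ω : Traj T X Y U => ω.2.1 t.succ) (updY t.succ) (by simp [updY])
    (by simp [updY]) (by simp [updY]) (fun ω => F ω * J2 M t ω) (kY M t)
    ((hF.mul (J2_dep M t)).updY t.succ (by simp))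
    (fun b => (kY_dep M t b).updY t.succ (by simp))
    (fun ω => M.g_sum _ _ _)
  simpa only [J3, mul_assoc] using this

theorem stage0 (M : CHMM T X Y U) (n : ℕ) (hn : n ≤ T) :
    ∃ c : ℝ, ∀ F : Traj T X Y U → ℝ, Dep (n + 1) (n + 1) n F →
      ∑ ω, F ω * M.p ω = c * ∑ ω, F ω * J M n ω := by
  induction hn using Nat.decreasingInduction with
  | self => exact ⟨1, fun F _ => by simp [J_top]⟩
  | of_succ n hn ih =>
    obtain ⟨c, hc⟩ := ih
    refine ⟨c * ((Fintype.card Y : ℝ)⁻¹ * ((Fintype.card X : ℝ)⁻¹ * (Fintype.card U : ℝ)⁻¹)),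
      fun F hF => ?_⟩
    have h3 := sumY M ⟨n, hn⟩ F (hF.mono (by simp) le_rfl (by simp))
    have h2 := sumX M ⟨n, hn⟩ F (hF.mono le_rfl le_rfl (by simp))
    have h1 := sumU M ⟨n, hn⟩ F hF
    rw [hc F (hF.mono (by simp) (by simp) (by simp)), h3, h2, h1]
    ring

theorem stageY (M : CHMM T X Y U) (t : Fin T) :
    ∃ c : ℝ, ∀ F : Traj T X Y U → ℝ, Dep (t + 2) (t + 2) (t + 1) F →
      ∑ ω, F ω * M.p ω = c * ∑ ω, F ω * J M (t + 1) ω := stage0 M (t + 1) t.isLt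
theorem stageX (M : CHMM T X Y U) (t : Fin T) :
    ∃ c : ℝ, ∀ F : Traj T X Y U → ℝ, Dep (t + 2) (t + 1) (t + 1) F →
      ∑ ω, F ω * M.p ω = c * ∑ ω, F ω * J2 M t ω := by
  obtain ⟨c, hc⟩ := stageY M t
  exact ⟨c * (Fintype.card Y : ℝ)⁻¹, fun F hF => by
    rw [hc F (hF.mono (by simp) (by simp) (by simp)), sumY M t F hF, mul_assoc]⟩
theorem stageU (M : CHMM T X Y U) (t : Fin T) :
    ∃ c : ℝ, ∀ F : Traj T X Y U → ℝ, Dep (t + 1) (t + 1) (t + 1) F →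
      ∑ ω, F ω * M.p ω = c * ∑ ω, F ω * J1 M t ω := by
  obtain ⟨c, hc⟩ := stageX M t
  exact ⟨c * (Fintype.card X : ℝ)⁻¹, fun F hF => by
    rw [hc F (hF.mono (by simp) (by simp) (by simp)), sumX M t F hF, mul_assoc]⟩

theorem indU (M : CHMM T X Y U) (t : Fin T) (F : Traj T X Y U → ℝ)
    (hF : Dep (t + 1) (t + 1) t F) (a : U) :
    ∑ ω, (F ω * if ω.2.2 t = a then 1 else 0) * M.p ω = ∑ ω, (F ω * kU M t a ω) * M.p ω := by
  obtain ⟨c, hc⟩ := stageU M t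
  have hF' := hF.mono (a' := t + 1) (b' := t + 1) (c' := t + 1) (by omega) (by omega) (by omega)
  rw [hc _ (hF'.mul fun ω ω' _ _ h3 => by rw [h3 t (by simp)]),
    hc _ (hF'.mul ((kU_dep M t a).mono (by omega) (by omega) (by omega)))]
  congr 1
  have := step_ind (fun ω : Traj T X Y U => ω.2.2 t) (updU t) (by simp [updU])
    (by simp [updU]) (by simp [updU]) (fun ω => F ω * J M t ω) (kU M t)
    ((hF.mul (J_dep M t)).updU t le_rfl) (fun b => (kU_dep M t b).updU t le_rfl)
    (fun ω => M.pol_sum _ _ _) a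
  calc _ = _ := sum_congr rfl fun ω _ => by simp only [J1]; ring
    _ = _ := this
    _ = _ := sum_congr rfl fun ω _ => by simp only [J1]; ring
theorem indX (M : CHMM T X Y U) (t : Fin T) (F : Traj T X Y U → ℝ)
    (hF : Dep (t + 1) (t + 1) (t + 1) F) (a : X) :
    ∑ ω, (F ω * if ω.1 t.succ = a then 1 else 0) * M.p ω =
      ∑ ω, (F ω * kX M t a ω) * M.p ω := by
  obtain ⟨c, hc⟩ := stageX M t
  have hF' := hF.mono (a' := t + 2) (b' := t + 1) (c' := t + 1) (by omega) (by omega) (by omega)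
  rw [hc _ (hF'.mul fun ω ω' h1 _ _ => by rw [h1 t.succ (by simp)]),
    hc _ (hF'.mul ((kX_dep M t a).mono (by omega) (by omega) (by omega)))]
  congr 1
  have := step_ind (fun ω : Traj T X Y U => ω.1 t.succ) (updX t.succ) (by simp [updX])
    (by simp [updX]) (by simp [updX]) (fun ω => F ω * J1 M t ω) (kX M t)
    ((hF.mul (J1_dep M t)).updX t.succ (by simp)) (fun b => (kX_dep M t b).updX t.succ (by simp))
    (fun ω => M.f_sum _ _ _) a
  calc _ = _ := sum_congr rfl fun ω _ => by simp only [J2]; ring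
    _ = _ := this
    _ = _ := sum_congr rfl fun ω _ => by simp only [J2]; ring
theorem indY (M : CHMM T X Y U) (t : Fin T) (F : Traj T X Y U → ℝ)
    (hF : Dep (t + 2) (t + 1) (t + 1) F) (a : Y) :
    ∑ ω, (F ω * if ω.2.1 t.succ = a then 1 else 0) * M.p ω =
      ∑ ω, (F ω * kY M t a ω) * M.p ω := by
  obtain ⟨c, hc⟩ := stageY M t
  have hF' := hF.mono (a' := t + 2) (b' := t + 2) (c' := t + 1) (by omega) (by omega) (by omega)
  rw [hc _ (hF'.mul fun ω ω' _ h2 _ => by rw [h2 t.succ (by simp)]),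
    hc _ (hF'.mul ((kY_dep M t a).mono (by omega) (by omega) (by omega)))]
  congr 1
  have := step_ind (fun ω : Traj T X Y U => ω.2.1 t.succ) (updY t.succ) (by simp [updY])
    (by simp [updY]) (by simp [updY]) (fun ω => F ω * J2 M t ω) (kY M t)
    ((hF.mul (J2_dep M t)).updY t.succ (by simp))
    (fun b => (kY_dep M t b).updY t.succ (by simp))
    (fun ω => M.g_sum _ _ _) a
  calc _ = _ := sum_congr rfl fun ω _ => by simp only [J3]; ring
    _ = _ := this
    _ = _ := sum_congr rfl fun ω _ => by simp only [J3]; ring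

theorem p_nonneg (M : CHMM T X Y U) (ω : Traj T X Y U) : 0 ≤ M.p ω :=
  mul_nonneg (mul_nonneg (M.p0_nonneg _) (M.g0_nonneg _ _))
    (prod_nonneg fun t _ => mul_nonneg (mul_nonneg (M.pol_nonneg _ _ _ _) (M.f_nonneg _ _ _ _))
      (M.g_nonneg _ _ _ _))

theorem prob_nonneg (M : CHMM T X Y U) {α : Type*} [DecidableEq α]
    (A : Traj T X Y U → α) (a : α) : 0 ≤ M.prob A a :=
  sum_nonneg fun ω _ => by split_ifs <;> simp [p_nonneg]

theorem prob_pos (M : CHMM T X Y U) {α : Type*} [DecidableEq α]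
    (A : Traj T X Y U → α) (ω : Traj T X Y U) (h : 0 < M.p ω) : 0 < M.prob A (A ω) := by
  refine sum_pos' (fun ω' _ => by split_ifs <;> simp [p_nonneg]) ⟨ω, mem_univ _, by simpa⟩

theorem prob_congr (M : CHMM T X Y U) {α β : Type*} [DecidableEq α] [DecidableEq β]
    (A : Traj T X Y U → α) (B : Traj T X Y U → β) (a : α) (b : β)
    (h : ∀ ω, A ω = a ↔ B ω = b) : M.prob A a = M.prob B b := by
  simp only [CHMM.prob, h]

/-- Generic split of a probability along a kernel. -/
theorem prob_split (M : CHMM T X Y U) {α β γ : Type*} [DecidableEq α] [DecidableEq β]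
    [DecidableEq γ] (A : Traj T X Y U → α) (B : Traj T X Y U → β) (c : Traj T X Y U → γ)
    (k : Traj T X Y U → ℝ) (ω0 : Traj T X Y U)
    (hs : ∀ ω, A ω = A ω0 ↔ B ω = B ω0 ∧ c ω = c ω0)
    (hE : ∑ ω, ((if B ω = B ω0 then 1 else 0) * if c ω = c ω0 then 1 else 0) * M.p ω =
      ∑ ω, ((if B ω = B ω0 then 1 else 0) * k ω) * M.p ω)
    (hk : ∀ ω, B ω = B ω0 → k ω = k ω0) :
    M.prob A (A ω0) = k ω0 * M.prob B (B ω0) := by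
  unfold CHMM.prob
  calc _ = _ := sum_congr rfl fun ω _ => by
        rw [if_congr (hs ω) rfl rfl, ite_and]
    _ = ∑ ω, ((if B ω = B ω0 then 1 else 0) * if c ω = c ω0 then 1 else 0) * M.p ω :=
        sum_congr rfl fun ω _ => by split_ifs <;> simp
    _ = _ := hE
    _ = _ := by
        rw [mul_sum]
        refine sum_congr rfl fun ω _ => ?_
        split_ifs with h
        · rw [hk ω h]; ring
        · simp

theorem Dep.ind {β : Type*} [DecidableEq β] {a b c : ℕ} {B : Traj T X Y U → β}
    (h : Dep a b c B) (b0 : β) : Dep a b c (fun ω => if B ω = b0 then (1 : ℝ) else 0) :=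
  fun ω ω' h1 h2 h3 => by simp only [h ω ω' h1 h2 h3]

theorem splitU (M : CHMM T X Y U) {α β : Type*} [DecidableEq α] [DecidableEq β]
    (t : Fin T) (A : Traj T X Y U → α) (B : Traj T X Y U → β) (ω0 : Traj T X Y U)
    (hB : Dep (t + 1) (t + 1) t B)
    (hs : ∀ ω, A ω = A ω0 ↔ B ω = B ω0 ∧ ω.2.2 t = ω0.2.2 t)
    (hk : ∀ ω, B ω = B ω0 → kU M t (ω0.2.2 t) ω = kU M t (ω0.2.2 t) ω0) :
    M.prob A (A ω0) = kU M t (ω0.2.2 t) ω0 * M.prob B (B ω0) :=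
  prob_split M A B (fun ω => ω.2.2 t) (kU M t (ω0.2.2 t)) ω0 hs
    (indU M t _ (hB.ind _) _) hk
theorem splitX (M : CHMM T X Y U) {α β : Type*} [DecidableEq α] [DecidableEq β]
    (t : Fin T) (A : Traj T X Y U → α) (B : Traj T X Y U → β) (ω0 : Traj T X Y U)
    (hB : Dep (t + 1) (t + 1) (t + 1) B)
    (hs : ∀ ω, A ω = A ω0 ↔ B ω = B ω0 ∧ ω.1 t.succ = ω0.1 t.succ)
    (hk : ∀ ω, B ω = B ω0 → kX M t (ω0.1 t.succ) ω = kX M t (ω0.1 t.succ) ω0) :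
    M.prob A (A ω0) = kX M t (ω0.1 t.succ) ω0 * M.prob B (B ω0) :=
  prob_split M A B (fun ω => ω.1 t.succ) (kX M t (ω0.1 t.succ)) ω0 hs
    (indX M t _ (hB.ind _) _) hk
theorem splitY (M : CHMM T X Y U) {α β : Type*} [DecidableEq α] [DecidableEq β]
    (t : Fin T) (A : Traj T X Y U → α) (B : Traj T X Y U → β) (ω0 : Traj T X Y U)
    (hB : Dep (t + 2) (t + 1) (t + 1) B)
    (hs : ∀ ω, A ω = A ω0 ↔ B ω = B ω0 ∧ ω.2.1 t.succ = ω0.2.1 t.succ)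
    (hk : ∀ ω, B ω = B ω0 → kY M t (ω0.2.1 t.succ) ω = kY M t (ω0.2.1 t.succ) ω0) :
    M.prob A (A ω0) = kY M t (ω0.2.1 t.succ) ω0 * M.prob B (B ω0) :=
  prob_split M A B (fun ω => ω.2.1 t.succ) (kY M t (ω0.2.1 t.succ)) ω0 hs
    (indY M t _ (hB.ind _) _) hk

/-! Expectations. -/
theorem sum_prob (M : CHMM T X Y U) {β : Type*} [Fintype β] [DecidableEq β]
    (B : Traj T X Y U → β) (Φ : β → ℝ) :
    ∑ b, M.prob B b * Φ b = ∑ ω, M.p ω * Φ (B ω) := by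
  simp only [CHMM.prob, sum_mul]
  rw [sum_comm]
  refine sum_congr rfl fun ω _ => ?_
  simp [ite_mul]

theorem sum_prob_pos (M : CHMM T X Y U) {β : Type*} [Fintype β] [DecidableEq β]
    (B : Traj T X Y U → β) (Φ : β → ℝ) :
    ∑ b ∈ univ.filter (fun b => 0 < M.prob B b), M.prob B b * Φ b =
      ∑ ω, M.p ω * Φ (B ω) := by
  rw [← sum_prob, sum_filter]
  refine sum_congr rfl fun b _ => ?_
  split_ifs with h
  · rfl
  · rw [le_antisymm (not_lt.mp h) (prob_nonneg M B b), zero_mul]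

theorem prob_zero_of (M : CHMM T X Y U) {α β : Type*} [DecidableEq α] [DecidableEq β]
    (A : Traj T X Y U → α) (B : Traj T X Y U → β) (a : α) (b : β)
    (h : ∀ ω, A ω = a → B ω = b) (hB : M.prob B b = 0) : M.prob A a = 0 := by
  refine le_antisymm (hB ▸ ?_) (prob_nonneg M A a)
  refine sum_le_sum fun ω _ => ?_
  by_cases hA : A ω = a
  · simp [hA, h ω hA]
  · rw [if_neg hA]; split_ifs <;> simp [p_nonneg]

theorem condEnt_eq (M : CHMM T X Y U) {α β : Type*} [Fintype α] [DecidableEq α]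
    [Fintype β] [DecidableEq β] (A : Traj T X Y U → α) (B : Traj T X Y U → β) :
    M.condEnt A B = -∑ ω, M.p ω *
      Real.log (M.prob (fun ω => (A ω, B ω)) (A ω, B ω) / M.prob B (B ω)) := by
  unfold CHMM.condEnt
  rw [← Fintype.sum_prod_type (f := fun q : α × β => M.prob (fun ω => (A ω, B ω)) (q.1, q.2) *
        Real.log (M.prob (fun ω => (A ω, B ω)) (q.1, q.2) / M.prob B q.2))]
  exact congrArg _ (sum_prob M (fun ω => (A ω, B ω)) fun q =>
    Real.log (M.prob (fun ω => (A ω, B ω)) (q.1, q.2) / M.prob B q.2))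

theorem E_pcondEnt (M : CHMM T X Y U) {α β : Type*} [Fintype α] [DecidableEq α]
    [Fintype β] [DecidableEq β] (A : Traj T X Y U → α) (B : Traj T X Y U → β) :
    ∑ ω, M.p ω * M.pcondEnt A B (B ω) = -∑ ω, M.p ω *
      Real.log (M.prob (fun ω => (A ω, B ω)) (A ω, B ω) / M.prob B (B ω)) := by
  rw [← condEnt_eq, ← sum_prob M B]
  unfold CHMM.pcondEnt CHMM.condEnt CHMM.cprob
  rw [sum_comm, ← sum_neg_distrib]
  refine sum_congr rfl fun b _ => ?_
  rw [mul_neg, mul_sum]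
  congr 1
  refine sum_congr rfl fun a _ => ?_
  by_cases h : M.prob B b = 0
  · rw [h, prob_zero_of M (fun ω => (A ω, B ω)) B (a, b) b (by simp) h]; simp
  · field_simp

theorem E_pcondEnt2 (M : CHMM T X Y U) {α α' β : Type*} [Fintype α] [DecidableEq α]
    [Fintype α'] [DecidableEq α']
    [Fintype β] [DecidableEq β] (A : Traj T X Y U → α) (A' : Traj T X Y U → α')
    (B : Traj T X Y U → β) :
    ∑ ω, M.p ω * M.pcondEnt2 A A' B (B ω) = -∑ ω, M.p ω *
      Real.log (M.prob (fun ω => (A ω, (A' ω, B ω))) (A ω, (A' ω, B ω)) /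
        M.prob (fun ω => (A' ω, B ω)) (A' ω, B ω)) := by
  rw [← condEnt_eq M A (fun ω => (A' ω, B ω)), ← sum_prob M B]
  unfold CHMM.pcondEnt2 CHMM.condEnt CHMM.cprob
  simp only [Fintype.sum_prod_type]
  have e : ∀ (a : α) (a' : α') (b : β), M.prob (fun ω => ((A ω, A' ω), B ω)) ((a, a'), b) =
      M.prob (fun ω => (A ω, (A' ω, B ω))) (a, (a', b)) := fun a a' b =>
    prob_congr M _ _ _ _ (by simp [and_assoc])
  have : ∀ b, M.prob B b * -∑ a, ∑ a',
      M.prob (fun ω => ((A ω, A' ω), B ω)) ((a, a'), b) / M.prob B b *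
        Real.log (M.prob (fun ω => (A ω, (A' ω, B ω))) (a, (a', b)) /
          M.prob (fun ω => (A' ω, B ω)) (a', b)) =
      -∑ a, ∑ a', M.prob (fun ω => (A ω, (A' ω, B ω))) (a, (a', b)) *
        Real.log (M.prob (fun ω => (A ω, (A' ω, B ω))) (a, (a', b)) /
          M.prob (fun ω => (A' ω, B ω)) (a', b)) := by
    intro b
    rw [mul_neg, mul_sum]
    congr 1
    refine sum_congr rfl fun a _ => ?_
    rw [mul_sum]
    refine sum_congr rfl fun a' _ => ?_
    rw [e]
    by_cases h : M.prob B b = 0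
    · rw [h, prob_zero_of M (fun ω => (A ω, (A' ω, B ω))) B (a, (a', b)) b (by simp) h]; simp
    · field_simp
  rw [sum_congr rfl fun b _ => this b, sum_neg_distrib]
  congr 1
  rw [sum_comm]
  refine sum_congr rfl fun a _ => ?_
  rw [sum_comm]

theorem Xpref_iff (n : ℕ) (h : n ≤ T + 1) (ω ω0 : Traj T X Y U) :
    Xpref T n h ω = Xpref T n h ω0 ↔ ∀ i : Fin (T + 1), (i : ℕ) < n → ω.1 i = ω0.1 i :=
  ⟨fun e i hi => congrFun e ⟨i, hi⟩, fun e => funext fun i => e (Fin.castLE h i) i.isLt⟩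
theorem Ypref_iff (n : ℕ) (h : n ≤ T + 1) (ω ω0 : Traj T X Y U) :
    Ypref T n h ω = Ypref T n h ω0 ↔ ∀ i : Fin (T + 1), (i : ℕ) < n → ω.2.1 i = ω0.2.1 i :=
  ⟨fun e i hi => congrFun e ⟨i, hi⟩, fun e => funext fun i => e (Fin.castLE h i) i.isLt⟩
theorem Upref_iff (n : ℕ) (h : n ≤ T) (ω ω0 : Traj T X Y U) :
    Upref T n h ω = Upref T n h ω0 ↔ ∀ i : Fin T, (i : ℕ) < n → ω.2.2 i = ω0.2.2 i :=
  ⟨fun e i hi => congrFun e ⟨i, hi⟩, fun e => funext fun i => e (Fin.castLE h i) i.isLt⟩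

theorem Xpref_dep (n : ℕ) (h : n ≤ T + 1) : Dep n 0 0 (Xpref T n h : Traj T X Y U → _) :=
  fun _ _ h1 _ _ => (Xpref_iff n h _ _).2 h1
theorem Ypref_dep (n : ℕ) (h : n ≤ T + 1) : Dep 0 n 0 (Ypref T n h : Traj T X Y U → _) :=
  fun _ _ _ h1 _ => (Ypref_iff n h _ _).2 h1
theorem Upref_dep (n : ℕ) (h : n ≤ T) : Dep 0 0 n (Upref T n h : Traj T X Y U → _) :=
  fun _ _ _ _ h1 => (Upref_iff n h _ _).2 h1
theorem Xat_dep (n : ℕ) (h : n < T + 1) : Dep (n + 1) 0 0 (Xat T n h : Traj T X Y U → _) :=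
  fun _ _ h1 _ _ => h1 ⟨n, h⟩ (by simp)
theorem Dep.pair {β γ : Type*} {a b c a' b' c' : ℕ} {F : Traj T X Y U → β}
    {G : Traj T X Y U → γ} (hF : Dep a b c F) (hG : Dep a' b' c' G) :
    Dep (max a a') (max b b') (max c c') (fun ω => (F ω, G ω)) := fun ω ω' h1 h2 h3 => by
  have e1 := hF.mono (le_max_left a a') (le_max_left b b') (le_max_left c c') ω ω' h1 h2 h3
  have e2 := hG.mono (le_max_right a a') (le_max_right b b') (le_max_right c c') ω ω' h1 h2 h3
  simp only [e1, e2]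

theorem split_lt1 (t : Fin T) (P : Fin (T + 1) → Prop) :
    (∀ i : Fin (T + 1), (i : ℕ) < (t : ℕ) + 1 + 1 → P i) ↔
      (∀ i : Fin (T + 1), (i : ℕ) < (t : ℕ) + 1 → P i) ∧ P t.succ := by
  constructor
  · exact fun h => ⟨fun i hi => h i (by omega), h _ (by simp)⟩
  · rintro ⟨h, h'⟩ i hi
    rcases Nat.lt_succ_iff_lt_or_eq.mp hi with hi | hi
    · exact h i hi
    · have : i = t.succ := Fin.ext hi
      rwa [this]
theorem split_lt2 (t : Fin T) (P : Fin T → Prop) :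
    (∀ i : Fin T, (i : ℕ) < (t : ℕ) + 1 → P i) ↔
      (∀ i : Fin T, (i : ℕ) < (t : ℕ) → P i) ∧ P t := by
  constructor
  · exact fun h => ⟨fun i hi => h i (by omega), h _ (by simp)⟩
  · rintro ⟨h, h'⟩ i hi
    rcases Nat.lt_succ_iff_lt_or_eq.mp hi with hi | hi
    · exact h i hi
    · have : i = t := Fin.ext hi
      rwa [this]

/-- Realized-probability of the full prefix. -/
noncomputable def PJ (M : CHMM T X Y U) (a b c : ℕ) (ha : a ≤ T + 1) (hb : b ≤ T + 1)
    (hc : c ≤ T) (ω0 : Traj T X Y U) : ℝ :=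
  M.prob (fun ω => (Xpref T a ha ω, (Ypref T b hb ω, Upref T c hc ω)))
    (Xpref T a ha ω0, (Ypref T b hb ω0, Upref T c hc ω0))
noncomputable def PN (M : CHMM T X Y U) (b c : ℕ) (hb : b ≤ T + 1)
    (hc : c ≤ T) (ω0 : Traj T X Y U) : ℝ :=
  M.prob (fun ω => (Ypref T b hb ω, Upref T c hc ω)) (Ypref T b hb ω0, Upref T c hc ω0)
noncomputable def PX (M : CHMM T X Y U) (s b c : ℕ) (hs : s < T + 1) (hb : b ≤ T + 1)
    (hc : c ≤ T) (ω0 : Traj T X Y U) : ℝ :=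
  M.prob (fun ω => (Xat T s hs ω, (Ypref T b hb ω, Upref T c hc ω)))
    (Xat T s hs ω0, (Ypref T b hb ω0, Upref T c hc ω0))
noncomputable def PXX (M : CHMM T X Y U) (s s' b c : ℕ) (hs : s < T + 1) (hs' : s' < T + 1)
    (hb : b ≤ T + 1) (hc : c ≤ T) (ω0 : Traj T X Y U) : ℝ :=
  M.prob (fun ω => (Xat T s hs ω, (Xat T s' hs' ω, (Ypref T b hb ω, Upref T c hc ω))))
    (Xat T s hs ω0, (Xat T s' hs' ω0, (Ypref T b hb ω0, Upref T c hc ω0)))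

theorem PN_U (M : CHMM T X Y U) (t : Fin T) (hb : (t : ℕ) + 1 ≤ T + 1) (hc : (t : ℕ) + 1 ≤ T)
    (hc' : (t : ℕ) ≤ T) (ω0 : Traj T X Y U) :
    PN M (t + 1) (t + 1) hb hc ω0 = kU M t (ω0.2.2 t) ω0 * PN M (t + 1) t hb hc' ω0 := by
  refine splitU M t (fun ω => (Ypref T _ hb ω, Upref T _ hc ω))
    (fun ω => (Ypref T _ hb ω, Upref T _ hc' ω)) ω0 ?_ ?_ ?_
  · exact ((Ypref_dep _ _).pair (Upref_dep _ _)).mono (by simp) (by simp) (by simp)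
  · intro ω
    simp only [Prod.mk.injEq, Ypref_iff, Upref_iff, split_lt2]
    tauto
  · intro ω h
    simp only [Prod.mk.injEq, Ypref_iff, Upref_iff] at h
    exact kU_dep M t _ ω ω0 (by simp) h.1 h.2
theorem PJ_U (M : CHMM T X Y U) (t : Fin T) (ha : (t : ℕ) + 1 ≤ T + 1)
    (hb : (t : ℕ) + 1 ≤ T + 1) (hc : (t : ℕ) + 1 ≤ T)
    (hc' : (t : ℕ) ≤ T) (ω0 : Traj T X Y U) :
    PJ M (t + 1) (t + 1) (t + 1) ha hb hc ω0 =
      kU M t (ω0.2.2 t) ω0 * PJ M (t + 1) (t + 1) t ha hb hc' ω0 := by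
  refine splitU M t (fun ω => (Xpref T _ ha ω, (Ypref T _ hb ω, Upref T _ hc ω)))
    (fun ω => (Xpref T _ ha ω, (Ypref T _ hb ω, Upref T _ hc' ω))) ω0 ?_ ?_ ?_
  · exact ((Xpref_dep _ _).pair ((Ypref_dep _ _).pair (Upref_dep _ _))).mono
      (by simp) (by simp) (by simp)
  · intro ω
    simp only [Prod.mk.injEq, Xpref_iff, Ypref_iff, Upref_iff, split_lt2]
    tauto
  · intro ω h
    simp only [Prod.mk.injEq, Ypref_iff, Upref_iff] at h
    exact kU_dep M t _ ω ω0 (by simp) h.2.1 h.2.2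
theorem PJ_X (M : CHMM T X Y U) (t : Fin T) (ha : (t : ℕ) + 1 ≤ T + 1)
    (ha' : (t : ℕ) + 1 + 1 ≤ T + 1)
    (hb : (t : ℕ) + 1 ≤ T + 1) (hc : (t : ℕ) + 1 ≤ T) (ω0 : Traj T X Y U) :
    PJ M (t + 1 + 1) (t + 1) (t + 1) ha' hb hc ω0 =
      kX M t (ω0.1 t.succ) ω0 * PJ M (t + 1) (t + 1) (t + 1) ha hb hc ω0 := by
  refine splitX M t (fun ω => (Xpref T _ ha' ω, (Ypref T _ hb ω, Upref T _ hc ω)))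
    (fun ω => (Xpref T _ ha ω, (Ypref T _ hb ω, Upref T _ hc ω))) ω0 ?_ ?_ ?_
  · exact ((Xpref_dep _ _).pair ((Ypref_dep _ _).pair (Upref_dep _ _))).mono
      (by simp) (by simp) (by simp)
  · intro ω
    simp only [Prod.mk.injEq, Xpref_iff, Ypref_iff, Upref_iff, split_lt1]
    tauto
  · intro ω h
    simp only [Prod.mk.injEq, Xpref_iff, Ypref_iff, Upref_iff] at h
    exact kX_dep M t _ ω ω0 h.1 (by simp) h.2.2
theorem PJ_Y (M : CHMM T X Y U) (t : Fin T) (ha : (t : ℕ) + 1 + 1 ≤ T + 1)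
    (hb : (t : ℕ) + 1 ≤ T + 1) (hc : (t : ℕ) + 1 ≤ T) (ω0 : Traj T X Y U) :
    PJ M (t + 1 + 1) (t + 1 + 1) (t + 1) ha ha hc ω0 =
      kY M t (ω0.2.1 t.succ) ω0 * PJ M (t + 1 + 1) (t + 1) (t + 1) ha hb hc ω0 := by
  refine splitY M t (fun ω => (Xpref T _ ha ω, (Ypref T _ ha ω, Upref T _ hc ω)))
    (fun ω => (Xpref T _ ha ω, (Ypref T _ hb ω, Upref T _ hc ω))) ω0 ?_ ?_ ?_
  · exact ((Xpref_dep _ _).pair ((Ypref_dep _ _).pair (Upref_dep _ _))).mono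
      (by simp) (by simp) (by simp)
  · intro ω
    simp only [Prod.mk.injEq, Xpref_iff, Ypref_iff, Upref_iff, split_lt1]
    tauto
  · intro ω h
    simp only [Prod.mk.injEq, Xpref_iff, Ypref_iff, Upref_iff] at h
    exact kY_dep M t _ ω ω0 h.1 (by simp) h.2.2
theorem PX_Y (M : CHMM T X Y U) (t : Fin T) (hs : (t : ℕ) + 1 < T + 1)
    (ha : (t : ℕ) + 1 + 1 ≤ T + 1)
    (hb : (t : ℕ) + 1 ≤ T + 1) (hc : (t : ℕ) + 1 ≤ T) (ω0 : Traj T X Y U) :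
    PX M (t + 1) (t + 1 + 1) (t + 1) hs ha hc ω0 =
      kY M t (ω0.2.1 t.succ) ω0 * PX M (t + 1) (t + 1) (t + 1) hs hb hc ω0 := by
  refine splitY M t (fun ω => (Xat T _ hs ω, (Ypref T _ ha ω, Upref T _ hc ω)))
    (fun ω => (Xat T _ hs ω, (Ypref T _ hb ω, Upref T _ hc ω))) ω0 ?_ ?_ ?_
  · exact ((Xat_dep _ _).pair ((Ypref_dep _ _).pair (Upref_dep _ _))).mono
      (by simp) (by simp) (by simp)
  · intro ω
    simp only [Prod.mk.injEq, Ypref_iff, Upref_iff, split_lt1]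
    tauto
  · intro ω h
    simp only [Prod.mk.injEq, Ypref_iff, Upref_iff] at h
    have h1 : ω.1 t.succ = ω0.1 t.succ := h.1
    unfold kY
    rw [h1, h.2.2 t (by simp)]
theorem PXX_X (M : CHMM T X Y U) (t : Fin T) (hs : (t : ℕ) + 1 < T + 1)
    (hs' : (t : ℕ) < T + 1)
    (hb : (t : ℕ) + 1 ≤ T + 1) (hc : (t : ℕ) + 1 ≤ T) (ω0 : Traj T X Y U) :
    PXX M (t + 1) t (t + 1) (t + 1) hs hs' hb hc ω0 =
      kX M t (ω0.1 t.succ) ω0 * PX M t (t + 1) (t + 1) hs' hb hc ω0 := by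
  refine splitX M t (fun ω => (Xat T _ hs ω, (Xat T _ hs' ω, (Ypref T _ hb ω, Upref T _ hc ω))))
    (fun ω => (Xat T _ hs' ω, (Ypref T _ hb ω, Upref T _ hc ω))) ω0 ?_ ?_ ?_
  · exact ((Xat_dep _ _).pair ((Ypref_dep _ _).pair (Upref_dep _ _))).mono
      (by simp) (by simp) (by simp)
  · intro ω
    have h1 : Xat T _ hs ω = ω.1 t.succ := rfl
    have h2 : Xat T _ hs ω0 = ω0.1 t.succ := rfl
    simp only [Prod.mk.injEq, h1, h2]
    tauto
  · intro ω h
    simp only [Prod.mk.injEq, Ypref_iff, Upref_iff] at h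
    have h1 : ω.1 t.castSucc = ω0.1 t.castSucc := h.1
    unfold kX
    rw [h1, h.2.2 t (by simp)]

theorem step_log (M : CHMM T X Y U) (t : Fin T) (hs : (t : ℕ) + 1 < T + 1)
    (hs' : (t : ℕ) < T + 1)
    (ha : (t : ℕ) + 1 + 1 ≤ T + 1)
    (hb : (t : ℕ) + 1 ≤ T + 1) (hc : (t : ℕ) + 1 ≤ T) (hc' : (t : ℕ) ≤ T)
    (ω0 : Traj T X Y U) (hp : 0 < M.p ω0) :
    Real.log (PX M (t + 1) (t + 1 + 1) (t + 1) hs ha hc ω0 / PN M (t + 1 + 1) (t + 1) ha hc ω0)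
    - Real.log (PX M (t + 1) (t + 1) (t + 1) hs hb hc ω0 / PN M (t + 1) (t + 1) hb hc ω0)
    + Real.log (PXX M (t + 1) t (t + 1) (t + 1) hs hs' hb hc ω0 /
        PX M t (t + 1) (t + 1) hs' hb hc ω0) =
    Real.log (PJ M (t + 1 + 1) (t + 1 + 1) (t + 1) ha ha hc ω0 /
        PN M (t + 1 + 1) (t + 1) ha hc ω0)
    - Real.log (PJ M (t + 1) (t + 1) t hb hb hc' ω0 / PN M (t + 1) t hb hc' ω0) := by
  have p1 : 0 < PX M (t + 1) (t + 1 + 1) (t + 1) hs ha hc ω0 :=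
    prob_pos M (fun ω => (Xat T _ hs ω, (Ypref T _ ha ω, Upref T _ hc ω))) ω0 hp
  have p2 : 0 < PN M (t + 1 + 1) (t + 1) ha hc ω0 :=
    prob_pos M (fun ω => (Ypref T _ ha ω, Upref T _ hc ω)) ω0 hp
  have p3 : 0 < PX M (t + 1) (t + 1) (t + 1) hs hb hc ω0 :=
    prob_pos M (fun ω => (Xat T _ hs ω, (Ypref T _ hb ω, Upref T _ hc ω))) ω0 hp
  have p4 : 0 < PN M (t + 1) (t + 1) hb hc ω0 :=
    prob_pos M (fun ω => (Ypref T _ hb ω, Upref T _ hc ω)) ω0 hp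
  have p5 : 0 < PXX M (t + 1) t (t + 1) (t + 1) hs hs' hb hc ω0 :=
    prob_pos M (fun ω => (Xat T _ hs ω, (Xat T _ hs' ω, (Ypref T _ hb ω, Upref T _ hc ω)))) ω0 hp
  have p6 : 0 < PX M t (t + 1) (t + 1) hs' hb hc ω0 :=
    prob_pos M (fun ω => (Xat T _ hs' ω, (Ypref T _ hb ω, Upref T _ hc ω))) ω0 hp
  have p7 : 0 < PJ M (t + 1) (t + 1) t hb hb hc' ω0 :=
    prob_pos M (fun ω => (Xpref T _ hb ω, (Ypref T _ hb ω, Upref T _ hc' ω))) ω0 hp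
  have p8 : 0 < PN M (t + 1) t hb hc' ω0 :=
    prob_pos M (fun ω => (Ypref T _ hb ω, Upref T _ hc' ω)) ω0 hp
  have e1 := PX_Y M t hs ha hb hc ω0
  have e2 := PXX_X M t hs hs' hb hc ω0
  have e3 := PN_U M t hb hc hc' ω0
  rw [PJ_Y M t ha hb hc, PJ_X M t hb ha hb hc, PJ_U M t hb hb hc hc']
  rw [e1] at p1 ⊢
  rw [e2] at p5 ⊢
  rw [e3] at p4 ⊢
  have q1 := (pos_of_mul_pos_left p1 p3.le).ne'
  have q2 := (pos_of_mul_pos_left p5 p6.le).ne'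
  have q3 := (pos_of_mul_pos_left p4 p8.le).ne'
  have p2 := p2.ne'
  have p3 := p3.ne'
  have p6 := p6.ne'
  have p7 := p7.ne'
  have p8 := p8.ne'
  rw [Real.log_div (by positivity) (by positivity), Real.log_div (by positivity) (by positivity),
    Real.log_div (by positivity) (by positivity), Real.log_div (by positivity) (by positivity),
    Real.log_div (by positivity) (by positivity),
    Real.log_mul (by positivity) (by positivity), Real.log_mul (by positivity) (by positivity),
    Real.log_mul (by positivity) (by positivity), Real.log_mul (by positivity) (by positivity),
    Real.log_mul (by positivity) (by positivity), Real.log_mul (by positivity) (by positivity)]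
  ring

/-- The pointwise log-likelihood terms. -/
noncomputable def logTerm (M : CHMM T X Y U) (t : Fin (T + 1)) (ω : Traj T X Y U) : ℝ :=
  if h0 : (t : ℕ) = 0 then
    Real.log (M.prob (fun ω => (Xat T 0 (by omega) ω, Yat T 0 (by omega) ω))
      (Xat T 0 (by omega) ω, Yat T 0 (by omega) ω) /
        M.prob (Yat T 0 (by omega)) (Yat T 0 (by omega) ω))
  else
    Real.log (PX M t (t + 1) t t.isLt (by omega) (by omega) ω /
      PN M (t + 1) t (by omega) (by omega) ω)
    - Real.log (PX M t t t t.isLt (by omega) (by omega) ω / PN M t t (by omega) (by omega) ω)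
    + Real.log (PXX M t (t - 1) t t t.isLt (by omega) (by omega) (by omega) ω /
      PX M (t - 1) t t (by omega) (by omega) (by omega) ω)

noncomputable def L (M : CHMM T X Y U) (ω : Traj T X Y U) (n : ℕ) : ℝ :=
  if h : n ≤ T then Real.log (PJ M (n + 1) (n + 1) n (by omega) (by omega) h ω /
    PN M (n + 1) n (by omega) h ω) else 0

theorem sum_term (M : CHMM T X Y U) (ω : Traj T X Y U) (hp : 0 < M.p ω) :
    ∑ t, logTerm M t ω = Real.log (PJ M (T + 1) (T + 1) T le_rfl le_rfl le_rfl ω /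
      PN M (T + 1) T le_rfl le_rfl ω) := by
  have h0 : logTerm M 0 ω = L M ω 0 := by
    unfold logTerm L
    rw [dif_pos (by simp), dif_pos (by simp)]
    unfold PJ PN
    congr 2
    · refine prob_congr M _ _ _ _ fun ω' => ?_
      simp only [Prod.mk.injEq, Xpref_iff, Ypref_iff, Upref_iff]
      simp [Fin.forall_fin_succ, Xat, Yat]
    · refine prob_congr M _ _ _ _ fun ω' => ?_
      simp only [Prod.mk.injEq, Xpref_iff, Ypref_iff, Upref_iff]
      simp [Fin.forall_fin_succ, Xat, Yat]
  have hS : ∀ t : Fin T, logTerm M t.succ ω = L M ω (t + 1) - L M ω t := by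
    intro t
    unfold logTerm L
    rw [dif_neg (by simp), dif_pos (by omega), dif_pos (by omega)]
    exact step_log M t (by omega) (by omega) (by omega) (by omega) (by omega) (by omega) ω hp
  rw [Fin.sum_univ_succ, h0, sum_congr rfl fun t _ => hS t,
    Fin.sum_univ_eq_sum_range (fun n => L M ω (n + 1) - L M ω n) T, sum_range_sub]
  unfold L
  simp


end

end SmootherAux

/-- The smoother entropy as the expectation, over positive-probability
realizations `(y^T, u^{T-1})`, of the sum of point-wise filter-entropy terms
`h(X_t | y^t, u^{t-1}) − h(X_t | y^{t-1}, u^{t-1}) + h(X_t | X_{t-1}, y^{t-1}, u^{t-1})`,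
with the `t = 0` terms interpreted as `h(X_0 | y_0)`, `H(X_0)`, `H(X_0)`. -/
theorem smoother_entropy_expectation_of_pointwise_terms
    {T : ℕ} {X Y U : Type*} [Fintype X] [Fintype Y] [Fintype U]
    [DecidableEq X] [DecidableEq Y] [DecidableEq U]
    (hT : 1 ≤ T) (M : CHMM T X Y U) :
    M.condEnt (Xpref T (T + 1) le_rfl)
        (fun ω => (Ypref T (T + 1) le_rfl ω, Upref T T le_rfl ω)) =
      ∑ b ∈ Finset.univ.filter (fun b : (Fin (T + 1) → Y) × (Fin T → U) =>
          0 < M.prob (fun ω => (Ypref T (T + 1) le_rfl ω, Upref T T le_rfl ω)) b),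
        M.prob (fun ω => (Ypref T (T + 1) le_rfl ω, Upref T T le_rfl ω)) b *
          ∑ t : Fin (T + 1),
            if h0 : (t : ℕ) = 0 then
              M.pcondEnt (Xat T 0 (by omega)) (Yat T 0 (by omega)) (b.1 0)
                - M.entropy (Xat T 0 (by omega)) + M.entropy (Xat T 0 (by omega))
            else
              M.pcondEnt (Xat T t t.isLt)
                  (fun ω => (Ypref T ((t : ℕ) + 1) (by have := t.isLt; omega) ω,
                    Upref T (t : ℕ) (by have := t.isLt; omega) ω))
                  (fun i => b.1 (Fin.castLE (by have := t.isLt; omega) i),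
                    fun i => b.2 (Fin.castLE (by have := t.isLt; omega) i))
                - M.pcondEnt (Xat T t t.isLt)
                  (fun ω => (Ypref T (t : ℕ) (by have := t.isLt; omega) ω,
                    Upref T (t : ℕ) (by have := t.isLt; omega) ω))
                  (fun i => b.1 (Fin.castLE (by have := t.isLt; omega) i),
                    fun i => b.2 (Fin.castLE (by have := t.isLt; omega) i))
                + M.pcondEnt2 (Xat T t t.isLt) (Xat T ((t : ℕ) - 1) (by have := t.isLt; omega))
                  (fun ω => (Ypref T (t : ℕ) (by have := t.isLt; omega) ω,
                    Upref T (t : ℕ) (by have := t.isLt; omega) ω))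
                  (fun i => b.1 (Fin.castLE (by have := t.isLt; omega) i),
                    fun i => b.2 (Fin.castLE (by have := t.isLt; omega) i)) := by
  rw [SmootherAux.condEnt_eq, SmootherAux.sum_prob_pos]
  have hl : ∀ ω, M.p ω * Real.log (M.prob (fun ω => (Xpref T (T + 1) le_rfl ω,
      (Ypref T (T + 1) le_rfl ω, Upref T T le_rfl ω))) (Xpref T (T + 1) le_rfl ω,
      (Ypref T (T + 1) le_rfl ω, Upref T T le_rfl ω)) /
      M.prob (fun ω => (Ypref T (T + 1) le_rfl ω, Upref T T le_rfl ω))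
        (Ypref T (T + 1) le_rfl ω, Upref T T le_rfl ω)) =
      ∑ t, M.p ω * SmootherAux.logTerm M t ω := by
    intro ω
    rcases (SmootherAux.p_nonneg M ω).eq_or_lt with h | h
    · simp [← h]
    · rw [← mul_sum, SmootherAux.sum_term M ω h]
      rfl
  rw [sum_congr rfl fun ω _ => hl ω, sum_comm, ← sum_neg_distrib]
  simp only [mul_sum]
  rw [sum_comm (s := (univ : Finset (Traj T X Y U)))]
  refine sum_congr rfl fun t _ => ?_
  by_cases h0 : (t : ℕ) = 0
  · simp only [SmootherAux.logTerm, dif_pos h0, sub_add_cancel]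
    exact (SmootherAux.E_pcondEnt M (Xat T 0 (by omega)) (Yat T 0 (by omega))).symm
  · simp only [SmootherAux.logTerm, dif_neg h0, mul_add, mul_sub, sum_add_distrib, sum_sub_distrib]
    have e1 := SmootherAux.E_pcondEnt M (Xat T t t.isLt)
      (fun ω => (Ypref T ((t : ℕ) + 1) (by omega) ω, Upref T (t : ℕ) (by omega) ω))
    have e2 := SmootherAux.E_pcondEnt M (Xat T t t.isLt)
      (fun ω => (Ypref T (t : ℕ) (by omega) ω, Upref T (t : ℕ) (by omega) ω))
    have e3 := SmootherAux.E_pcondEnt2 M (Xat T t t.isLt) (Xat T ((t : ℕ) - 1) (by omega))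
      (fun ω => (Ypref T (t : ℕ) (by omega) ω, Upref T (t : ℕ) (by omega) ω))
    refine Eq.trans ?_ (congrArg₂ (· + ·) (congrArg₂ (· - ·) e1 e2) e3).symm
    simp only [SmootherAux.PX, SmootherAux.PN, SmootherAux.PXX]
    ring
end
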